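/- For every positive integer m, the set B_2(m) is a compact subset of ℝ. -/

import Mathlib

/-- A sequence of digits has a last nonzero digit. -/
def hasLastNonzero (c : ℕ → ℕ) : Prop := ∃ n, c n ≠ 0 ∧ ∀ i > n, c i = 0

/-- `c` (with `c i` the `(i+1)`-st digit) is a `q`-expansion of `x`
with respect to the digit set `Ω_m = {0,1,…,m}`. -/
def isExpansion (m : ℕ) (q : ℝ) (x : ℝ) (c : ℕ → ℕ) : Prop :=
  (∀ i, c i ≤ m) ∧ x = ∑' i : ℕ, (c i : ℝ) / q ^ (i + 1)

/-- The set `U_q` of points of `I_q = [0, m/(q-1)]` with a unique `q`-expansion. -/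
def Uq (m : ℕ) (q : ℝ) : Set ℝ :=
  {x | x ∈ Set.Icc 0 ((m : ℝ) / (q - 1)) ∧ ∃! c, isExpansion m q x c}

/-- The set `U'_q` of digit sequences that are unique `q`-expansions. -/
def Uq' (m : ℕ) (q : ℝ) : Set (ℕ → ℕ) :=
  {c | isExpansion m q (∑' i : ℕ, (c i : ℝ) / q ^ (i + 1)) c ∧
       ∀ d, isExpansion m q (∑' i : ℕ, (c i : ℝ) / q ^ (i + 1)) d → d = c}

/-- `B_2(m)`: bases `q ∈ (1, m+1]` for which some `x ∈ I_q` has exactly two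
different `q`-expansions. -/
def B2 (m : ℕ) : Set ℝ :=
  {q | q ∈ Set.Ioc 1 ((m : ℝ) + 1) ∧
    ∃ x ∈ Set.Icc (0 : ℝ) ((m : ℝ) / (q - 1)), ∃ a b : ℕ → ℕ,
      a ≠ b ∧ isExpansion m q x a ∧ isExpansion m q x b ∧
      ∀ c, isExpansion m q x c → c = a ∨ c = b}

/-- Strict lexicographic order on digit sequences. -/
def lexLt (a b : ℕ → ℕ) : Prop := ∃ n, (∀ i < n, a i = b i) ∧ a n < b n

/-- Lexicographic order on digit sequences. -/
def lexLe (a b : ℕ → ℕ) : Prop := lexLt a b ∨ a = b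

/-- `a` is the quasi-greedy `q`-expansion of `1`: the lexicographically largest
`q`-expansion of `1` without a last nonzero digit. -/
def isQuasiGreedy (m : ℕ) (q : ℝ) (a : ℕ → ℕ) : Prop :=
  isExpansion m q 1 a ∧ ¬ hasLastNonzero a ∧
  ∀ b, isExpansion m q 1 b → ¬ hasLastNonzero b → lexLe b a

/-- `A'_q = {(c_i) ∈ U'_q : c_1 < α_1(q)}`. -/
def Aq' (m : ℕ) (q : ℝ) : Set (ℕ → ℕ) :=
  {c | c ∈ Uq' m q ∧ ∀ a, isQuasiGreedy m q a → c 0 < a 0}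

/-- `f_{c,d}(t) = (m+1)/t + Σ_{i≥1} (c_i + d_i) t^{-(i+1)} - m/(t-1)`. -/
noncomputable def fcd (m : ℕ) (c d : ℕ → ℕ) (t : ℝ) : ℝ :=
  ((m : ℝ) + 1) / t + (∑' i : ℕ, ((c i : ℝ) + (d i : ℝ)) / t ^ (i + 2)) - (m : ℝ) / (t - 1)

/-- `x = q_f(m)`: the largest real root of `q³-(k+2)q²+q-(k+1)=0` if `m = 2k+1`,
and of `q²-(k+1)q-k=0` if `m = 2k`. -/
def isQf (m : ℕ) (x : ℝ) : Prop :=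
  (∃ k : ℕ, m = 2 * k + 1 ∧
    x ^ 3 - ((k : ℝ) + 2) * x ^ 2 + x - ((k : ℝ) + 1) = 0 ∧
    ∀ y : ℝ, y ^ 3 - ((k : ℝ) + 2) * y ^ 2 + y - ((k : ℝ) + 1) = 0 → y ≤ x) ∨
  (∃ k : ℕ, m = 2 * k ∧
    x ^ 2 - ((k : ℝ) + 1) * x - (k : ℝ) = 0 ∧
    ∀ y : ℝ, y ^ 2 - ((k : ℝ) + 1) * y - (k : ℝ) = 0 → y ≤ x)

/-- A doubly infinite sequence: neither it nor its reflection has a last nonzero digit. -/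
def doublyInfinite (m : ℕ) (c : ℕ → ℕ) : Prop :=
  ¬ hasLastNonzero c ∧ ¬ hasLastNonzero (fun i => m - c i)

/-- `V_q`: points of `I_q` with at most one doubly infinite `q`-expansion. -/
def Vq (m : ℕ) (q : ℝ) : Set ℝ :=
  {x | x ∈ Set.Icc 0 ((m : ℝ) / (q - 1)) ∧
    ∀ a b : ℕ → ℕ, isExpansion m q x a → isExpansion m q x b →
      doublyInfinite m a → doublyInfinite m b → a = b}

/-- `U = {q ∈ (1, m+1] : 1 ∈ U_q}`. -/
def Uset (m : ℕ) : Set ℝ := {q | q ∈ Set.Ioc 1 ((m : ℝ) + 1) ∧ (1 : ℝ) ∈ Uq m q}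

/-- `V = {q ∈ (1, m+1] : 1 ∈ V_q}`. -/
def Vset (m : ℕ) : Set ℝ := {q | q ∈ Set.Ioc 1 ((m : ℝ) + 1) ∧ (1 : ℝ) ∈ Vq m q}

/-- The generalized golden ratio `G(m)`. -/
noncomputable def Gratio (m : ℕ) : ℝ :=
  if m % 2 = 0 then ((m / 2 : ℕ) : ℝ) + 1
  else (((m / 2 : ℕ) : ℝ) + 1 +
    Real.sqrt (((m / 2 : ℕ) : ℝ) ^ 2 + 6 * ((m / 2 : ℕ) : ℝ) + 5)) / 2

/-- The set of accumulation points of a set of reals. -/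
def accPts (S : Set ℝ) : Set ℝ := {x | AccPt x (Filter.principal S)}

/-- Iterated accumulation-point sets `B_2^{(i)}(m)`. -/
def B2iter (m : ℕ) : ℕ → Set ℝ
  | 0 => B2 m
  | n + 1 => accPts (B2iter m n)

/-- The value in base `q` of the tail of `c` starting at index `n`. -/
noncomputable def tailVal (q : ℝ) (c : ℕ → ℕ) (n : ℕ) : ℝ :=
  ∑' i : ℕ, (c (n + i) : ℝ) / q ^ (i + 1)

/-- Digitwise reflection. -/
def reflect (m : ℕ) (c : ℕ → ℕ) : ℕ → ℕ := fun i => m - c i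

/-- The first `n` digits of `c` followed by `f`. -/
def splice (c : ℕ → ℕ) (n : ℕ) (f : ℕ → ℕ) : ℕ → ℕ :=
  fun i => if i < n then c i else f (i - n)

/-- The value characterisation of sequences that are unique expansions. -/
def IsStrict (m : ℕ) (q : ℝ) (c : ℕ → ℕ) : Prop :=
  (∀ i, c i ≤ m) ∧ ∀ n, (c n < m → tailVal q c (n + 1) < 1) ∧
    (0 < c n → (m : ℝ) / (q - 1) - 1 < tailVal q c (n + 1))

/-- The closed version of `IsStrict`. -/
def IsWeak (m : ℕ) (q : ℝ) (c : ℕ → ℕ) : Prop :=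
  (∀ i, c i ≤ m) ∧ ∀ n, (c n < m → tailVal q c (n + 1) ≤ 1) ∧
    (0 < c n → (m : ℝ) / (q - 1) - 1 ≤ tailVal q c (n + 1))

section Values

variable {m : ℕ} {q : ℝ} {a b c f : ℕ → ℕ}

lemma hasSum_geometric_digits (m : ℕ) (hq : 1 < q) :
    HasSum (fun i : ℕ => (m : ℝ) / q ^ (i + 1)) ((m : ℝ) / (q - 1)) := by
  have h0 : (0 : ℝ) < q := by linarith
  have h := (hasSum_geometric_of_lt_one (inv_nonneg.2 h0.le) (inv_lt_one_of_one_lt₀ hq)).mul_left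
    ((m : ℝ) / q)
  have e1 : (fun i : ℕ => (m : ℝ) / q ^ (i + 1)) = fun i => (m : ℝ) / q * q⁻¹ ^ i := by
    funext i
    rw [pow_succ, inv_pow]
    field_simp
  have e2 : (m : ℝ) / (q - 1) = (m : ℝ) / q * (1 - q⁻¹)⁻¹ := by
    have h1 : q - 1 ≠ 0 := by linarith
    have h2 : 1 - q⁻¹ = (q - 1) / q := by field_simp
    rw [h2]
    field_simp
  rw [e1, e2]
  exact h

lemma summable_digits (hq : 1 < q) (hc : ∀ i, c i ≤ m) (n : ℕ) :
    Summable fun i : ℕ => (c (n + i) : ℝ) / q ^ (i + 1) := by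
  have h0 : (0 : ℝ) < q := by linarith
  refine Summable.of_nonneg_of_le (fun i => by positivity) (fun i => ?_)
    (hasSum_geometric_digits m hq).summable
  have : (c (n + i) : ℝ) ≤ m := by exact_mod_cast hc _
  gcongr

lemma tailVal_nonneg (hq : 1 < q) (c : ℕ → ℕ) (n : ℕ) : 0 ≤ tailVal q c n := by
  have h0 : (0 : ℝ) < q := by linarith
  exact tsum_nonneg fun i => by positivity

lemma tailVal_le (hq : 1 < q) (hc : ∀ i, c i ≤ m) (n : ℕ) :
    tailVal q c n ≤ (m : ℝ) / (q - 1) := by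
  have h0 : (0 : ℝ) < q := by linarith
  rw [← (hasSum_geometric_digits m hq).tsum_eq]
  refine (summable_digits hq hc n).tsum_le_tsum (fun i => ?_)
    (hasSum_geometric_digits m hq).summable
  have : (c (n + i) : ℝ) ≤ m := by exact_mod_cast hc _
  gcongr

lemma tailVal_step (hq : 1 < q) (hc : ∀ i, c i ≤ m) (n : ℕ) :
    q * tailVal q c n = c n + tailVal q c (n + 1) := by
  have h0 : (0 : ℝ) < q := by linarith
  unfold tailVal
  rw [(summable_digits hq hc n).tsum_eq_zero_add, mul_add, ← tsum_mul_left]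
  congr 1
  · simp; field_simp
  · refine tsum_congr fun i => ?_
    rw [show n + (i + 1) = n + 1 + i by ring, pow_succ q (i + 1)]
    field_simp

lemma tailVal_shift (q : ℝ) (c : ℕ → ℕ) (k n : ℕ) :
    tailVal q (fun i => c (k + i)) n = tailVal q c (k + n) := by
  simp only [tailVal, add_assoc]

lemma tailVal_congr {i j : ℕ} (q : ℝ) (h : ∀ l, a (i + l) = b (j + l)) :
    tailVal q a i = tailVal q b j := by
  simp only [tailVal, h]

lemma tailVal_zero (q : ℝ) (c : ℕ → ℕ) :
    tailVal q c 0 = ∑' i : ℕ, (c i : ℝ) / q ^ (i + 1) := by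
  simp [tailVal]

lemma eq_zero_of_bounded_of_mul {x : ℕ → ℝ} {C : ℝ} (hq : 1 < q) (hb : ∀ n, |x n| ≤ C)
    (hx : ∀ n, x (n + 1) = q * x n) (n : ℕ) : x n = 0 := by
  by_contra h
  have h0 : (0 : ℝ) < q := by linarith
  have hpow : ∀ k, x (n + k) = q ^ k * x n := by
    intro k
    induction k with
    | zero => simp
    | succ k ih => rw [← add_assoc, hx, ih]; ring
  obtain ⟨k, hk⟩ := pow_unbounded_of_one_lt (C / |x n|) hq
  have h1 := hb (n + k)
  rw [hpow, abs_mul, abs_of_pos (pow_pos h0 k)] at h1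
  rw [div_lt_iff₀ (abs_pos.2 h)] at hk
  linarith

/-- A bounded solution of the recurrence of tail values is the sequence of tail values. -/
lemma eq_tailVal {x : ℕ → ℝ} {C : ℝ} (hq : 1 < q) (hc : ∀ i, c i ≤ m) (hb : ∀ n, |x n| ≤ C)
    (hx : ∀ n, q * x n = c n + x (n + 1)) (n : ℕ) : tailVal q c n = x n := by
  have := eq_zero_of_bounded_of_mul (x := fun n => x n - tailVal q c n)
    (C := C + (m : ℝ) / (q - 1)) hq ?_ ?_ n
  · linarith
  · intro n
    refine (abs_sub _ _).trans ?_
    rw [abs_of_nonneg (tailVal_nonneg hq c n)]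
    exact add_le_add (hb n) (tailVal_le hq hc n)
  · intro n
    have h1 := hx n
    have h2 := tailVal_step hq hc n
    linarith

lemma reflect_le (m : ℕ) (c : ℕ → ℕ) (i : ℕ) : reflect m c i ≤ m := Nat.sub_le _ _

lemma cast_reflect (hc : ∀ i, c i ≤ m) (i : ℕ) : (reflect m c i : ℝ) = m - c i := by
  simp [reflect, Nat.cast_sub (hc i)]

lemma tailVal_reflect (hq : 1 < q) (hc : ∀ i, c i ≤ m) (n : ℕ) :
    tailVal q (reflect m c) n = (m : ℝ) / (q - 1) - tailVal q c n := by
  refine eq_tailVal (m := m) (x := fun n => (m : ℝ) / (q - 1) - tailVal q c n)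
    (C := (m : ℝ) / (q - 1)) hq (reflect_le m c) (fun n => ?_) (fun n => ?_) n
  · have h1 := tailVal_nonneg hq c n
    have h2 := tailVal_le hq hc n
    rw [abs_of_nonneg (by linarith)]
    linarith
  · have h2 := tailVal_step hq hc n
    have : q - 1 ≠ 0 := by linarith
    have h3 : q * ((m : ℝ) / (q - 1)) = m + (m : ℝ) / (q - 1) := by field_simp; ring
    rw [cast_reflect hc]
    linarith

/-- Two tails sharing their first `p` digits. -/
lemma tailVal_sub_of_agree (hq : 1 < q) (ha : ∀ i, a i ≤ m) (hb : ∀ i, b i ≤ m) {i j : ℕ} (p : ℕ)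
    (h : ∀ l < p, a (i + l) = b (j + l)) :
    q ^ p * (tailVal q a i - tailVal q b j) = tailVal q a (i + p) - tailVal q b (j + p) := by
  induction p with
  | zero => simp
  | succ p ih =>
    have h1 := ih fun l hl => h l (by omega)
    have h2 := tailVal_step hq ha (i + p)
    have h3 := tailVal_step hq hb (j + p)
    rw [h p (by omega)] at h2
    rw [← add_assoc, ← add_assoc, pow_succ, mul_comm (q ^ p), mul_assoc, h1]
    linarith

lemma tailVal_lt_of_agree (hq : 1 < q) (ha : ∀ i, a i ≤ m) (hb : ∀ i, b i ≤ m) {i j p : ℕ}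
    (h : ∀ l < p, a (i + l) = b (j + l)) (hlt : a (i + p) < b (j + p))
    (ht : tailVal q a (i + p + 1) < tailVal q b (j + p + 1) + 1) :
    tailVal q a i < tailVal q b j := by
  have h1 := tailVal_sub_of_agree hq ha hb p h
  have h2 := tailVal_step hq ha (i + p)
  have h3 := tailVal_step hq hb (j + p)
  have h4 : (a (i + p) : ℝ) + 1 ≤ b (j + p) := by exact_mod_cast hlt
  have h0 : (0 : ℝ) < q := by linarith
  have h5 : tailVal q a (i + p) < tailVal q b (j + p) := by
    refine lt_of_mul_lt_mul_left ?_ h0.le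
    linarith
  have h6 : q ^ p * (tailVal q a i - tailVal q b j) < 0 := by linarith
  by_contra hcon
  have : 0 ≤ q ^ p * (tailVal q a i - tailVal q b j) :=
    mul_nonneg (by positivity) (by linarith)
  linarith

lemma splice_le (hc : ∀ i, c i ≤ m) (hf : ∀ i, f i ≤ m) (n i : ℕ) : splice c n f i ≤ m := by
  unfold splice
  split_ifs
  exacts [hc _, hf _]

lemma splice_of_lt {n i : ℕ} (h : i < n) : splice c n f i = c i := if_pos h

lemma splice_add (n i : ℕ) : splice c n f (n + i) = f i := by simp [splice]

lemma tailVal_splice_add (q : ℝ) (n i : ℕ) :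
    tailVal q (splice c n f) (n + i) = tailVal q f i :=
  tailVal_congr q fun l => by rw [add_assoc, splice_add]

lemma tailVal_splice_zero (hq : 1 < q) (hc : ∀ i, c i ≤ m) (hf : ∀ i, f i ≤ m) {n : ℕ}
    (h : tailVal q f 0 = tailVal q c n) : tailVal q (splice c n f) 0 = tailVal q c 0 := by
  have h1 := tailVal_sub_of_agree hq (splice_le hc hf n) hc (i := 0) (j := 0) n
    (fun l hl => by simpa using splice_of_lt (by simpa using hl))
  have h2 : tailVal q (splice c n f) (0 + n) = tailVal q c (0 + n) := by
    rw [zero_add, ← h]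
    exact tailVal_splice_add q n 0
  rw [h2, sub_self] at h1
  have h0 : q ^ n ≠ 0 := by positivity
  have := (mul_eq_zero.1 h1).resolve_left h0
  linarith

lemma tailVal_cons (hq : 1 < q) {d : ℕ} (hd : d ≤ m) (hf : ∀ i, f i ≤ m) :
    q * tailVal q (splice (fun _ => d) 1 f) 0 = d + tailVal q f 0 := by
  rw [tailVal_step hq (splice_le (fun _ => hd) hf 1) 0, splice_of_lt one_pos]
  congr 1
  exact tailVal_splice_add q 1 0

/-- Every point of `[0, m/(q-1)]` has an expansion. -/
lemma exists_tailVal_eq (hq : 1 < q) (hqm : q ≤ m + 1) {x : ℝ} (hx0 : 0 ≤ x)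
    (hx1 : x ≤ (m : ℝ) / (q - 1)) : ∃ f : ℕ → ℕ, (∀ i, f i ≤ m) ∧ tailVal q f 0 = x := by
  have h0 : (0 : ℝ) < q := by linarith
  have hq1 : 0 < q - 1 := by linarith
  have h3 : q * ((m : ℝ) / (q - 1)) = m + (m : ℝ) / (q - 1) := by field_simp; ring
  have h4 : 1 ≤ (m : ℝ) / (q - 1) := by rw [le_div_iff₀ hq1]; linarith
  let dig : ℝ → ℕ := fun y => min m ⌊q * y⌋₊
  let y : ℕ → ℝ := fun n => Nat.rec x (fun _ z => q * z - dig z) n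
  have hy : ∀ n, 0 ≤ y n ∧ y n ≤ (m : ℝ) / (q - 1) := by
    intro n
    induction n with
    | zero => exact ⟨hx0, hx1⟩
    | succ n ih =>
      obtain ⟨i1, i2⟩ := ih
      have hpos : 0 ≤ q * y n := by positivity
      change 0 ≤ q * y n - dig (y n) ∧ q * y n - dig (y n) ≤ (m : ℝ) / (q - 1)
      have e1 := Nat.floor_le hpos
      have e2 := Nat.lt_floor_add_one (q * y n)
      have e3 : q * y n ≤ q * ((m : ℝ) / (q - 1)) := by gcongr
      rcases le_total m ⌊q * y n⌋₊ with h | h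
      · have : dig (y n) = m := min_eq_left h
        rw [this]
        have : (m : ℝ) ≤ ⌊q * y n⌋₊ := by exact_mod_cast h
        constructor <;> linarith
      · have : dig (y n) = ⌊q * y n⌋₊ := min_eq_right h
        rw [this]
        constructor <;> linarith
  refine ⟨fun n => dig (y n), fun i => min_le_left _ _, ?_⟩
  refine eq_tailVal (m := m) (x := y) (C := (m : ℝ) / (q - 1)) hq (fun i => min_le_left _ _)
    (fun n => ?_) (fun n => ?_) 0
  · rw [abs_of_nonneg (hy n).1]; exact (hy n).2
  · change q * y n = dig (y n) + (q * y n - dig (y n))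
    ring

end Values


section Characterisation

variable {m : ℕ} {q : ℝ} {a b c d f : ℕ → ℕ}

lemma isExpansion_iff {x : ℝ} : isExpansion m q x c ↔ (∀ i, c i ≤ m) ∧ tailVal q c 0 = x := by
  rw [isExpansion, tailVal_zero, eq_comm]

/-- An admissible change of the `n`-th digit extends to another expansion. -/
lemma exists_replace_digit (hq : 1 < q) (hqm : q ≤ m + 1) (hc : ∀ i, c i ≤ m) (n : ℕ) {k : ℕ}
    (hk : k ≤ m) (h0 : 0 ≤ tailVal q c (n + 1) + c n - k)
    (h1 : tailVal q c (n + 1) + c n - k ≤ (m : ℝ) / (q - 1)) :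
    ∃ g : ℕ → ℕ, (∀ i, g i ≤ m) ∧ tailVal q g 0 = tailVal q c 0 ∧ g n = k := by
  obtain ⟨f, hf, hfv⟩ := exists_tailVal_eq hq hqm h0 h1
  have h2 := tailVal_cons hq hk hf
  have h3 := tailVal_step hq hc n
  have hs : ∀ i, splice (fun _ => k) 1 f i ≤ m := splice_le (fun _ => hk) hf 1
  refine ⟨splice c n (splice (fun _ => k) 1 f), splice_le hc hs n,
    tailVal_splice_zero hq hc hs ?_, ?_⟩
  · have : q * tailVal q (splice (fun _ => k) 1 f) 0 = q * tailVal q c n := by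
      rw [h2, h3, hfv]; ring
    exact mul_left_cancel₀ (by linarith) this
  · exact splice_add n 0

lemma isStrict_of_unique (hq : 1 < q) (hqm : q ≤ m + 1) (hc : ∀ i, c i ≤ m)
    (hu : ∀ f : ℕ → ℕ, (∀ i, f i ≤ m) → tailVal q f 0 = tailVal q c 0 → f = c) :
    IsStrict m q c := by
  refine ⟨hc, fun n => ⟨fun hn => ?_, fun hn => ?_⟩⟩
  · by_contra! h
    have h1 := tailVal_le hq hc (n + 1)
    obtain ⟨g, hg, hgv, hgn⟩ := exists_replace_digit hq hqm hc n (k := c n + 1) hn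
      (by push_cast; linarith) (by push_cast; linarith)
    rw [hu g hg hgv] at hgn
    omega
  · by_contra! h
    have h1 := tailVal_nonneg hq c (n + 1)
    have h2 : ((c n - 1 : ℕ) : ℝ) = c n - 1 := by
      rw [Nat.cast_sub (by omega)]; simp
    have h3 := hc n
    obtain ⟨g, hg, hgv, hgn⟩ := exists_replace_digit hq hqm hc n (k := c n - 1) (by omega)
      (by rw [h2]; linarith) (by rw [h2]; linarith)
    rw [hu g hg hgv] at hgn
    omega

lemma exists_first_diff (h : a ≠ b) : ∃ n, (∀ i < n, a i = b i) ∧ a n ≠ b n := by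
  classical
  have hex : ∃ n, a n ≠ b n := by
    by_contra! hcon
    exact h (funext hcon)
  refine ⟨Nat.find hex, fun i hi => ?_, Nat.find_spec hex⟩
  simpa using Nat.find_min hex hi

lemma tailVal_eq_of_agree (hq : 1 < q) (ha : ∀ i, a i ≤ m) (hb : ∀ i, b i ≤ m)
    (hv : tailVal q a 0 = tailVal q b 0) {n : ℕ} (h : ∀ i < n, a i = b i) :
    tailVal q a n = tailVal q b n := by
  have h1 := tailVal_sub_of_agree hq ha hb (i := 0) (j := 0) n (by simpa using h)
  rw [hv, sub_self, mul_zero, zero_add] at h1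
  linarith

lemma IsStrict.unique (hq : 1 < q) (hc : IsStrict m q c) (hf : ∀ i, f i ≤ m)
    (hv : tailVal q f 0 = tailVal q c 0) : f = c := by
  by_contra hne
  obtain ⟨n, hn, hd⟩ := exists_first_diff hne
  have h1 := tailVal_eq_of_agree hq hf hc.1 hv hn
  have h2 := tailVal_step hq hf n
  have h3 := tailVal_step hq hc.1 n
  rw [h1, h3] at h2
  obtain ⟨h4, h5⟩ := hc.2 n
  rcases lt_or_gt_of_ne hd with h | h
  · have h6 := h5 (by omega)
    have h7 := tailVal_le hq hf (n + 1)
    have h8 : (f n : ℝ) + 1 ≤ c n := by exact_mod_cast h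
    linarith
  · have h6 := h4 (by have := hf n; omega)
    have h7 := tailVal_nonneg hq f (n + 1)
    have h8 : (c n : ℝ) + 1 ≤ f n := by exact_mod_cast h
    linarith

lemma IsStrict.reflect (hq : 1 < q) (hc : IsStrict m q c) : IsStrict m q (reflect m c) := by
  refine ⟨reflect_le m c, fun n => ?_⟩
  rw [tailVal_reflect hq hc.1]
  obtain ⟨h1, h2⟩ := hc.2 n
  have := hc.1 n
  constructor
  · intro h
    have := h2 (by simp only [_root_.reflect] at h; omega)
    linarith
  · intro h
    have := h1 (by simp only [_root_.reflect] at h; omega)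
    linarith

lemma IsWeak.reflect (hq : 1 < q) (hc : IsWeak m q c) : IsWeak m q (reflect m c) := by
  refine ⟨reflect_le m c, fun n => ?_⟩
  rw [tailVal_reflect hq hc.1]
  obtain ⟨h1, h2⟩ := hc.2 n
  have := hc.1 n
  constructor
  · intro h
    have := h2 (by simp only [_root_.reflect] at h; omega)
    linarith
  · intro h
    have := h1 (by simp only [_root_.reflect] at h; omega)
    linarith

lemma IsStrict.isWeak (hc : IsStrict m q c) : IsWeak m q c :=
  ⟨hc.1, fun n => ⟨fun h => ((hc.2 n).1 h).le, fun h => ((hc.2 n).2 h).le⟩⟩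

lemma IsStrict.shift (hc : IsStrict m q c) (k : ℕ) : IsStrict m q (fun i => c (k + i)) :=
  ⟨fun i => hc.1 _, fun n => by
    rw [tailVal_shift]
    exact hc.2 (k + n)⟩

lemma IsWeak.shift (hc : IsWeak m q c) (k : ℕ) : IsWeak m q (fun i => c (k + i)) :=
  ⟨fun i => hc.1 _, fun n => by
    rw [tailVal_shift]
    exact hc.2 (k + n)⟩

/-- If there are exactly two expansions, splitting at index `n`, the tails after that index are
uniquely determined. -/
lemma isStrict_tail_of_two (hq : 1 < q) (hqm : q ≤ m + 1) (ha : ∀ i, a i ≤ m)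
    {n : ℕ} (hd : a n ≠ b n)
    (htwo : ∀ g : ℕ → ℕ, (∀ i, g i ≤ m) → tailVal q g 0 = tailVal q a 0 → g = a ∨ g = b) :
    IsStrict m q (fun i => a (n + 1 + i)) := by
  refine isStrict_of_unique hq hqm (fun i => ha _) fun f hf hfv => ?_
  rw [tailVal_shift, add_zero] at hfv
  rcases htwo _ (splice_le ha hf (n + 1)) (tailVal_splice_zero hq ha hf hfv) with h | h
  · funext i
    rw [← h, splice_add]
  · exact absurd (by rw [← h, splice_of_lt (Nat.lt_succ_self n)]) hd

lemma exists_strict_pair_of_lt (hq : 1 < q) (hqm : q ≤ m + 1) (ha : ∀ i, a i ≤ m)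
    (hb : ∀ i, b i ≤ m) (hv : tailVal q a 0 = tailVal q b 0) {n : ℕ} (hn : ∀ i < n, a i = b i)
    (hlt : a n < b n)
    (htwo : ∀ g : ℕ → ℕ, (∀ i, g i ≤ m) → tailVal q g 0 = tailVal q a 0 → g = a ∨ g = b) :
    ∃ c d, IsStrict m q c ∧ IsStrict m q d ∧ tailVal q d 0 = tailVal q c 0 + 1 := by
  have h1 := tailVal_eq_of_agree hq ha hb hv hn
  have h2 := tailVal_step hq ha n
  have h3 := tailVal_step hq hb n
  rw [h1, h3] at h2
  have hsucc : b n = a n + 1 := by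
    by_contra hne
    have h4 : a n + 1 < b n := by omega
    have h5 : (a n : ℝ) + 1 + 1 ≤ b n := by exact_mod_cast h4
    have h6 := tailVal_nonneg hq b (n + 1)
    have h7 := tailVal_le hq ha (n + 1)
    obtain ⟨g, hg, hgv, hgn⟩ := exists_replace_digit hq hqm ha n (k := a n + 1)
      (by have := hb n; omega) (by push_cast; linarith) (by push_cast; linarith)
    rcases htwo g hg hgv with h | h <;> rw [h] at hgn <;> omega
  refine ⟨_, _, isStrict_tail_of_two hq hqm hb hlt.ne' fun g hg hgv => ?_,
    isStrict_tail_of_two hq hqm ha hlt.ne htwo, ?_⟩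
  · exact (htwo g hg (hgv.trans hv.symm)).symm
  · rw [tailVal_shift, tailVal_shift, add_zero]
    have : (b n : ℝ) = a n + 1 := by exact_mod_cast hsucc
    linarith

lemma exists_strict_pair_of_mem_B2 (h : q ∈ B2 m) :
    1 < q ∧ q ≤ m + 1 ∧
      ∃ c d, IsStrict m q c ∧ IsStrict m q d ∧ tailVal q d 0 = tailVal q c 0 + 1 := by
  obtain ⟨⟨hq, hqm⟩, x, -, a, b, hab, ha, hb, htwo⟩ := h
  rw [isExpansion_iff] at ha hb
  simp only [isExpansion_iff] at htwo
  refine ⟨hq, hqm, ?_⟩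
  obtain ⟨n, hn, hd⟩ := exists_first_diff hab
  rcases lt_or_gt_of_ne hd with h | h
  · exact exists_strict_pair_of_lt hq hqm ha.1 hb.1 (ha.2.trans hb.2.symm) hn h
      fun g hg hgv => htwo g ⟨hg, hgv.trans ha.2⟩
  · exact exists_strict_pair_of_lt hq hqm hb.1 ha.1 (hb.2.trans ha.2.symm)
      (fun i hi => (hn i hi).symm) h fun g hg hgv => (htwo g ⟨hg, hgv.trans hb.2⟩).symm

lemma mem_B2_of_strict_pair (hm : 0 < m) (hq : 1 < q) (hqm : q ≤ m + 1) (hL : (m : ℝ) / (q - 1) < 2)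
    (hc : IsStrict m q c) (hd : IsStrict m q d) (hv : tailVal q d 0 = tailVal q c 0 + 1) :
    q ∈ B2 m := by
  have h0 : 0 < q := by linarith
  have ha := splice_le (f := d) (fun _ => Nat.zero_le m) hd.1 1
  have hb := splice_le (f := c) (fun _ => (hm : 1 ≤ m)) hc.1 1
  have hva := tailVal_cons hq (Nat.zero_le m) hd.1
  have hvb := tailVal_cons hq (hm : 1 ≤ m) hc.1
  have hc2 : tailVal q c 0 < 1 := by
    have := tailVal_le hq hd.1 0
    linarith
  have key : ∀ {k : ℕ} {f g : ℕ → ℕ}, (∀ i, f i ≤ m) → IsStrict m q g → f 0 = k →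
      (q * tailVal q f 0 = k + tailVal q g 0) → f = splice (fun _ => k) 1 g := by
    intro k f g hf hg hf0 hfv
    have h1 := tailVal_step hq hf 0
    have h2 : tailVal q (fun i => f (1 + i)) 0 = tailVal q g 0 := by
      rw [tailVal_shift, add_zero]
      rw [hf0] at h1
      rw [zero_add] at h1
      linarith
    have h3 := hg.unique hq (fun i => hf _) h2
    funext i
    rcases i with _ | i
    · rw [splice_of_lt one_pos, hf0]
    · rw [add_comm, splice_add, ← h3]
  refine ⟨⟨hq, hqm⟩, tailVal q (splice (fun _ => 0) 1 d) 0,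
    ⟨tailVal_nonneg hq _ _, tailVal_le hq ha 0⟩, splice (fun _ => 0) 1 d, splice (fun _ => 1) 1 c,
    ?_, isExpansion_iff.2 ⟨ha, rfl⟩, isExpansion_iff.2 ⟨hb, ?_⟩, ?_⟩
  · intro h
    have := congrFun h 0
    rw [splice_of_lt one_pos, splice_of_lt one_pos] at this
    omega
  · refine mul_left_cancel₀ h0.ne' ?_
    rw [hva, hvb, hv]
    push_cast
    ring
  · intro f hf
    rw [isExpansion_iff] at hf
    obtain ⟨hf, hfv⟩ := hf
    have h1 := tailVal_step hq hf 0
    have h2 := tailVal_nonneg hq f (0 + 1)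
    have h3 : q * tailVal q f 0 = 1 + tailVal q c 0 := by
      rw [hfv, hva, hv]
      push_cast
      ring
    have h4 : f 0 < 2 := by
      have : (f 0 : ℝ) < 2 := by linarith
      exact_mod_cast this
    interval_cases hf0 : f 0
    · exact Or.inl (key hf hd hf0 (by rw [h3, hv]; push_cast; ring))
    · exact Or.inr (key hf hc hf0 (by rw [h3]; push_cast; ring))

end Characterisation


/-- All tails of `e` have value in `[m/(q-1) - 1, 1]`, and `e` itself has value `1`. -/
def IsTrapped (m : ℕ) (q : ℝ) (e : ℕ → ℕ) : Prop :=
  (∀ i, e i ≤ m) ∧ tailVal q e 0 = 1 ∧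
    ∀ n, (m : ℝ) / (q - 1) - 1 ≤ tailVal q e n ∧ tailVal q e n ≤ 1

/-- Every suffix of the first `l` digits of `e` is lexicographically larger than the
corresponding prefix of the reflection of `e`. -/
def SuffixesDominate (m : ℕ) (e : ℕ → ℕ) (l : ℕ) : Prop :=
  ∀ i < l, ∃ p, i + p < l ∧ (∀ j < p, e (i + j) + e j = m) ∧ m < e (i + p) + e p

/-- The periodic sequence obtained from the first `l` digits of `e` by lowering the last one. -/
def lowerPeriodic (e : ℕ → ℕ) (l : ℕ) : ℕ → ℕ :=
  fun i => if i % l + 1 = l then e (i % l) - 1 else e (i % l)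

section Construction

variable {m : ℕ} {q : ℝ} {e : ℕ → ℕ}

lemma IsWeak.isTrapped (hq : 1 < q) (hL2 : (m : ℝ) / (q - 1) < 2) (he : IsWeak m q e)
    (h1 : tailVal q e 0 = 1) : IsTrapped m q e := by
  refine ⟨he.1, h1, fun n => ?_⟩
  induction n with
  | zero => constructor <;> linarith
  | succ n ih =>
    have hs := tailVal_step hq he.1 n
    have hle := tailVal_le hq he.1 n
    have hnn := tailVal_nonneg hq e n
    rw [le_div_iff₀ (by linarith)] at hle
    obtain ⟨w1, w2⟩ := he.2 n
    constructor
    · rcases Nat.eq_zero_or_pos (e n) with h | h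
      · rw [h, Nat.cast_zero] at hs
        nlinarith
      · exact w2 h
    · rcases (he.1 n).lt_or_eq with h | h
      · exact w1 h
      · rw [h] at hs
        nlinarith

lemma IsTrapped.digit_le (hq : 1 < q) (hL : 1 < (m : ℝ) / (q - 1)) (he : IsTrapped m q e)
    {i p : ℕ} (h : ∀ j < p, e (i + j) = e j) : e (i + p) ≤ e p := by
  by_contra! hlt
  have := tailVal_lt_of_agree hq he.1 he.1 (i := 0) (j := i) (p := p)
    (fun l hl => by rw [h l hl, zero_add]) (by rwa [zero_add])
    (by linarith [(he.2.2 (0 + p + 1)).2, (he.2.2 (i + p + 1)).1])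
  linarith [he.2.1, (he.2.2 i).2]

lemma IsTrapped.le_digit_add (hq : 1 < q) (hL : 1 < (m : ℝ) / (q - 1)) (he : IsTrapped m q e)
    {i p : ℕ} (h : ∀ j < p, e (i + j) + e j = m) : m ≤ e (i + p) + e p := by
  by_contra! hlt
  have := tailVal_lt_of_agree hq he.1 (reflect_le m e) (i := i) (j := 0) (p := p)
    (fun l hl => by have := h l hl; simp only [reflect, zero_add]; omega)
    (by simp only [reflect, zero_add]; omega)
    (by
      rw [tailVal_reflect hq he.1]
      linarith [(he.2.2 (0 + p + 1)).2, (he.2.2 (i + p + 1)).2])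
  rw [tailVal_reflect hq he.1] at this
  linarith [he.2.1, (he.2.2 i).1]

lemma IsTrapped.exists_dominating (hq : 1 < q) (hL : 1 < (m : ℝ) / (q - 1))
    (he : IsTrapped m q e) {i : ℕ} (hi : (m : ℝ) / (q - 1) - 1 < tailVal q e i) :
    ∃ p, (∀ j < p, e (i + j) + e j = m) ∧ m < e (i + p) + e p := by
  classical
  have hex : ∃ p, e (i + p) + e p ≠ m := by
    by_contra! hcon
    have : tailVal q e i = tailVal q (reflect m e) 0 :=
      tailVal_congr q fun l => by
        have := hcon l
        simp only [reflect, zero_add]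
        omega
    rw [tailVal_reflect hq he.1, he.2.1] at this
    linarith
  have hmin : ∀ j < Nat.find hex, e (i + j) + e j = m := fun j hj => by
    simpa using Nat.find_min hex hj
  exact ⟨Nat.find hex, hmin, lt_of_le_of_ne (he.le_digit_add hq hL hmin) (Nat.find_spec hex).symm⟩

lemma IsTrapped.exists_suffixesDominate (hq : 1 < q) (hL : 1 < (m : ℝ) / (q - 1))
    (he : IsTrapped m q e) (hlow : ∀ i, (m : ℝ) / (q - 1) - 1 < tailVal q e i) (l₀ : ℕ) :
    ∃ l, l₀ ≤ l ∧ SuffixesDominate m e l := by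
  classical
  by_cases hgood : SuffixesDominate m e l₀
  · exact ⟨l₀, le_rfl, hgood⟩
  let Bad : ℕ → Prop := fun i =>
    ¬ ∃ p, i + p < l₀ ∧ (∀ j < p, e (i + j) + e j = m) ∧ m < e (i + p) + e p
  have hex : ∃ i, i < l₀ ∧ Bad i := by
    simpa [SuffixesDominate, Bad] using hgood
  obtain ⟨hi, hbad⟩ := Nat.find_spec hex
  set i := Nat.find hex with hidef
  have hmin : ∀ i' < i, ¬ Bad i' := fun i' hi' hb =>
    Nat.find_min hex hi' ⟨by omega, hb⟩
  obtain ⟨p, hp, hpd⟩ := he.exists_dominating hq hL (hlow i)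
  have hpl : l₀ ≤ i + p := by
    by_contra! hcon
    exact hbad ⟨p, hcon, hp, hpd⟩
  refine ⟨i + p + 1, by omega, fun i' hi' => ?_⟩
  rcases lt_trichotomy i' i with h | h | h
  · obtain ⟨p', h1, h2⟩ := not_not.1 (hmin i' h)
    exact ⟨p', by omega, h2⟩
  · subst h
    exact ⟨p, by omega, hp, hpd⟩
  · obtain ⟨r, rfl⟩ := Nat.exists_eq_add_of_lt h
    set r' := r + 1 with hr'
    by_cases hall : ∀ j < p - r', e (r' + j) = e j
    · refine ⟨p - r', by omega, fun j hj => ?_, ?_⟩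
      · rw [show i + r + 1 + j = i + (r' + j) by omega, ← hall j hj]
        exact hp _ (by omega)
      · have := he.digit_le hq hL hall
        rw [show i + r + 1 + (p - r') = i + p by omega]
        rw [show r' + (p - r') = p by omega] at this
        omega
    · have hex2 : ∃ s, s < p - r' ∧ e (r' + s) ≠ e s := by
        simpa using hall
      obtain ⟨hs, hsne⟩ := Nat.find_spec hex2
      set s := Nat.find hex2 with hsdef
      have hsmin : ∀ j < s, e (r' + j) = e j := fun j hj => by
        by_contra hcon
        exact Nat.find_min hex2 hj ⟨by omega, hcon⟩
      have hlt : e (r' + s) < e s := lt_of_le_of_ne (he.digit_le hq hL hsmin) hsne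
      refine ⟨s, by omega, fun j hj => ?_, ?_⟩
      · rw [show i + r + 1 + j = i + (r' + j) by omega, ← hsmin j hj]
        exact hp _ (by omega)
      · rw [show i + r + 1 + s = i + (r' + s) by omega]
        have := hp (r' + s) (by omega)
        omega

lemma lowerPeriodic_of_lt {l i : ℕ} (h : i + 1 < l) : lowerPeriodic e l i = e i := by
  unfold lowerPeriodic
  rw [Nat.mod_eq_of_lt (by omega), if_neg (by omega)]

lemma lowerPeriodic_last {l i : ℕ} (h : i + 1 = l) : lowerPeriodic e l i = e i - 1 := by
  unfold lowerPeriodic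
  rw [Nat.mod_eq_of_lt (by omega), if_pos h]

lemma lowerPeriodic_le (he : ∀ i, e i ≤ m) (l i : ℕ) : lowerPeriodic e l i ≤ m := by
  have := he (i % l)
  unfold lowerPeriodic
  split_ifs <;> omega

lemma tailVal_lowerPeriodic_add (q : ℝ) (l i : ℕ) :
    tailVal q (lowerPeriodic e l) (l + i) = tailVal q (lowerPeriodic e l) i :=
  tailVal_congr q fun j => by
    simp only [lowerPeriodic]
    rw [add_assoc, Nat.add_mod_left]

lemma tailVal_lowerPeriodic_mul (q : ℝ) (l k i : ℕ) :
    tailVal q (lowerPeriodic e l) (l * k + i) = tailVal q (lowerPeriodic e l) i := by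
  induction k with
  | zero => simp
  | succ k ih =>
    rw [show l * (k + 1) + i = l + (l * k + i) by ring, tailVal_lowerPeriodic_add, ih]

lemma SuffixesDominate.last_pos (he : ∀ i, e i ≤ m) {l : ℕ}
    (hl : SuffixesDominate m e (l + 1)) : 0 < e l := by
  obtain ⟨p, h1, -, h2⟩ := hl l (by omega)
  obtain rfl : p = 0 := by omega
  have := he 0
  rw [add_zero] at h2
  omega

lemma tailVal_sub_lowerPeriodic (hq : 1 < q) (he : ∀ i, e i ≤ m) {l : ℕ} (hpos : 0 < e l) {i j : ℕ}
    (hij : i + j = l) :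
    q ^ (j + 1) * (tailVal q e i - tailVal q (lowerPeriodic e (l + 1)) i) =
      1 + tailVal q e (l + 1) - tailVal q (lowerPeriodic e (l + 1)) 0 := by
  have hle := lowerPeriodic_le he (l + 1)
  have h1 := tailVal_sub_of_agree hq he hle (i := i) (j := i) j
    (fun k hk => (lowerPeriodic_of_lt (by omega)).symm)
  rw [hij] at h1
  have h2 := tailVal_step hq he l
  have h3 := tailVal_step hq hle l
  rw [lowerPeriodic_last rfl, Nat.cast_sub (show 1 ≤ e l from hpos)] at h3
  have h4 := tailVal_lowerPeriodic_add (e := e) q (l + 1) 0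
  rw [add_zero] at h4
  rw [pow_succ, mul_comm (q ^ j), mul_assoc, h1, mul_sub, h2, h3, h4]
  push_cast
  ring

lemma tailVal_lowerPeriodic_bounds (hq : 1 < q) (hL : 1 < (m : ℝ) / (q - 1))
    (he : IsTrapped m q e) {l : ℕ} (hl : SuffixesDominate m e (l + 1)) (h0 : m < 2 * e 0)
    (hl0 : l = 0 → m + 2 ≤ 2 * e 0) (n : ℕ) :
    (m : ℝ) / (q - 1) - 1 < tailVal q (lowerPeriodic e (l + 1)) n ∧
      tailVal q (lowerPeriodic e (l + 1)) n < 1 := by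
  have hpos := hl.last_pos he.1
  have hle := lowerPeriodic_le he.1 (l + 1)
  set t := lowerPeriodic e (l + 1) with ht
  have hr := tailVal_reflect hq he.1
  have ht0 : m < t 0 + e 0 := by
    rcases Nat.eq_zero_or_pos l with h | h
    · have := hl0 h
      rw [ht, lowerPeriodic_last (by omega)]
      omega
    · rw [ht, lowerPeriodic_of_lt (by omega)]
      omega
  have hq0 : 0 < q := by linarith
  have ht0pos : 0 < tailVal q t 0 := by
    have h1 := tailVal_step hq hle 0
    have h2 := tailVal_nonneg hq t (0 + 1)
    have h3 : (1 : ℝ) ≤ t 0 := by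
      have := he.1 0
      exact_mod_cast (show 1 ≤ t 0 by omega)
    by_contra! hcon
    nlinarith
  have htpos : ∀ i, 0 < tailVal q t i := by
    intro i
    refine lt_of_le_of_ne (tailVal_nonneg hq t i) fun h => ?_
    have hz : ∀ k, tailVal q t (i + k) = 0 := by
      intro k
      induction k with
      | zero => exact h.symm
      | succ k ih =>
        have h1 := tailVal_step hq hle (i + k)
        have h2 := tailVal_nonneg hq t (i + k + 1)
        have h3 : (0 : ℝ) ≤ t (i + k) := by positivity
        rw [ih] at h1
        rw [← add_assoc]
        linarith
    have h1 := hz (l * i)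
    rw [show i + l * i = (l + 1) * i + 0 by ring, tailVal_lowerPeriodic_mul] at h1
    linarith
  have hup0 : tailVal q t 0 < 1 := by
    have h1 := tailVal_sub_lowerPeriodic hq he.1 hpos (zero_add l)
    rw [he.2.1] at h1
    by_contra! hcon
    have h2 : 1 ≤ q ^ (l + 1) := one_le_pow₀ hq.le
    nlinarith [(he.2.2 (l + 1)).1]
  suffices H : ∀ i < l + 1, (m : ℝ) / (q - 1) - 1 < tailVal q t i ∧ tailVal q t i < 1 by
    rw [← Nat.div_add_mod n (l + 1), tailVal_lowerPeriodic_mul]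
    exact H _ (Nat.mod_lt _ (by omega))
  have hlow : ∀ {i k p : ℕ}, (∀ j < p, t (i + j) + e (k + j) = m) → m < t (i + p) + e (k + p) →
      (m : ℝ) / (q - 1) - tailVal q e k < tailVal q t i := by
    intro i k p h1 h2
    have := tailVal_lt_of_agree hq (reflect_le m e) hle (i := k) (j := i) (p := p)
      (fun j hj => by have := h1 j hj; simp only [reflect]; omega)
      (by have := he.1 (k + p); simp only [reflect]; omega)
      (by rw [hr]; linarith [(he.2.2 (k + p + 1)).1, htpos (i + p + 1)])
    rwa [hr] at this
  intro i hi
  constructor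
  · obtain ⟨p, hp1, hp2, hp3⟩ := hl i hi
    rcases Nat.eq_zero_or_pos i with rfl | hipos
    · have := hlow (i := 0) (k := 0) (p := 0) (by simp) (by simpa using ht0)
      rwa [he.2.1] at this
    · have hagree : ∀ j < p, t (i + j) + e (0 + j) = m := fun j hj => by
        rw [ht, lowerPeriodic_of_lt (by omega), zero_add]
        exact hp2 j hj
      by_cases hlt : m < t (i + p) + e p
      · have := hlow (i := i) (k := 0) (p := p) hagree (by rwa [zero_add])
        rwa [he.2.1] at this
      have hlast : i + p = l := by
        by_contra hne
        rw [ht, lowerPeriodic_of_lt (by omega)] at hlt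
        exact hlt hp3
      have htl : t (i + p) + e p = m := by
        rw [ht, lowerPeriodic_last (by omega)] at hlt ⊢
        rw [hlast] at hp3 hlt ⊢
        omega
      have hmain : tailVal q (reflect m e) (p + 1) < tailVal q t 0 := by
        obtain ⟨p', h1, h2, h3⟩ := hl (p + 1) (by omega)
        rw [hr]
        refine hlow (p := p') (fun j hj => ?_) ?_
        · rw [ht, lowerPeriodic_of_lt (by omega), zero_add, add_comm]
          exact h2 j hj
        · rw [ht, lowerPeriodic_of_lt (by omega), zero_add, add_comm (e p')]
          exact h3
      have hsub := tailVal_sub_of_agree hq hle (reflect_le m e) (i := i) (j := 0) (p + 1)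
        (fun j hj => by
          have : t (i + j) + e j = m := by
            rcases (Nat.lt_succ_iff.1 hj).lt_or_eq with h | h
            · simpa using hagree j h
            · rwa [h]
          simp only [reflect, zero_add]
          omega)
      rw [show i + (p + 1) = (l + 1) + 0 by omega, tailVal_lowerPeriodic_add, zero_add, hr 0,
        he.2.1] at hsub
      by_contra! hcon
      have : q ^ (p + 1) * (tailVal q t i - ((m : ℝ) / (q - 1) - 1)) ≤ 0 :=
        mul_nonpos_of_nonneg_of_nonpos (by positivity) (by linarith)
      linarith
  · obtain ⟨j, hj⟩ := Nat.exists_eq_add_of_le (Nat.lt_succ_iff.1 hi)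
    have h1 := tailVal_sub_lowerPeriodic hq he.1 hpos hj.symm
    by_contra! hcon
    have h2 : q ^ (j + 1) * (tailVal q e i - tailVal q t i) ≤ 0 :=
      mul_nonpos_of_nonneg_of_nonpos (by positivity) (by linarith [(he.2.2 i).2])
    linarith [(he.2.2 (l + 1)).1]

end Construction


section Pairs

variable {m : ℕ} {q : ℝ} {e g u : ℕ → ℕ}

lemma IsTrapped.tailVal_lt_one_of_initial (hq : 1 < q) (hL : 1 < (m : ℝ) / (q - 1))
    (he : IsTrapped m q e) (hg : ∀ i, g i ≤ m) {n : ℕ} (hn : tailVal q g n < 1)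
    (h : ∀ i, 1 ≤ i → i < n →
      (∃ p, i + p < n ∧ (∀ j < p, g (i + j) = e j) ∧ g (i + p) < e p) ∨
      ((∀ j < n - i, g (i + j) = e j) ∧ tailVal q g n < tailVal q e (n - i)))
    (k : ℕ) : ∀ i, 1 ≤ i → i + k = n → tailVal q g i < 1 := by
  induction k using Nat.strong_induction_on with
  | _ k ih =>
    intro i hi hik
    rcases Nat.eq_zero_or_pos k with rfl | hk
    · rwa [← hik, add_zero] at hn
    rcases h i hi (by omega) with ⟨p, h1, h2, h3⟩ | ⟨h2, h3⟩
    · rw [← he.2.1]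
      refine tailVal_lt_of_agree hq hg he.1 (p := p) (by simpa using h2) (by simpa using h3) ?_
      have := ih (k - (p + 1)) (by omega) (i + p + 1) (by omega) (by omega)
      linarith [(he.2.2 (0 + p + 1)).1]
    · have h4 := tailVal_sub_of_agree hq hg he.1 (i := i) (j := 0) (n - i) (by simpa using h2)
      rw [show i + (n - i) = n by omega, zero_add, he.2.1] at h4
      by_contra! hcon
      have : 0 ≤ q ^ (n - i) * (tailVal q g i - 1) :=
        mul_nonneg (by positivity) (by linarith)
      linarith

lemma exists_strict_pair_of_initial (hq : 1 < q) (hL : 1 < (m : ℝ) / (q - 1))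
    (he : IsTrapped m q e) (hu : ∀ i, u i ≤ m)
    (hub : ∀ i, (m : ℝ) / (q - 1) - 1 < tailVal q u i ∧ tailVal q u i < 1)
    (hg : ∀ i, g i ≤ m) {n : ℕ} (hgu : ∀ i, g (n + i) = u i)
    (h : ∀ i, 1 ≤ i → i < n →
      (∃ p, i + p < n ∧ (∀ j < p, g (i + j) = e j) ∧ g (i + p) < e p) ∨
      ((∀ j < n - i, g (i + j) = e j) ∧ tailVal q u 0 < tailVal q e (n - i)))
    (hlow : ∀ i, 1 ≤ i → i < n → (m : ℝ) / (q - 1) - 1 < tailVal q g i)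
    {N : ℕ} (hN : q ^ N * (tailVal q g 0 - 1) = tailVal q u 0) :
    ∃ c d, IsStrict m q c ∧ IsStrict m q d ∧ tailVal q d 0 = tailVal q c 0 + 1 := by
  have hq0 : 0 < q := by linarith
  have hgt : ∀ i, tailVal q g (n + i) = tailVal q u i := fun i =>
    tailVal_congr q fun l => by rw [add_assoc, hgu]
  have hgn : tailVal q g n = tailVal q u 0 := hgt 0
  have hz := splice_le (c := fun _ => 0) (fun _ => Nat.zero_le m) hu N
  have hzero : ∀ i, tailVal q (fun _ => 0) i = 0 := fun i => by simp [tailVal]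
  have hzv : ∀ i j, i + j = N →
      q ^ j * tailVal q (splice (fun _ => 0) N u) i = tailVal q u 0 := by
    intro i j hij
    have h1 := tailVal_sub_of_agree hq hz (fun _ => Nat.zero_le m) (b := fun _ => 0)
      (i := i) (j := 0) j (fun l hl => splice_of_lt (by omega))
    rw [hzero, hzero, sub_zero, sub_zero, hij] at h1
    rw [h1]
    exact tailVal_splice_add q N 0
  refine ⟨splice (fun _ => 0) N u, g, ⟨hz, fun k => ?_⟩, ⟨hg, fun k => ?_⟩, ?_⟩
  · rcases lt_or_ge k N with hk | hk
    · rw [splice_of_lt hk]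
      refine ⟨fun _ => ?_, fun h => absurd h (by simp)⟩
      have h1 := hzv (k + 1) (N - (k + 1)) (by omega)
      have h2 : 1 ≤ q ^ (N - (k + 1)) := one_le_pow₀ hq.le
      by_contra! hcon
      nlinarith [(hub 0).2]
    · rw [show k + 1 = N + (k + 1 - N) by omega, tailVal_splice_add]
      exact ⟨fun _ => (hub _).2, fun _ => (hub _).1⟩
  · rcases lt_trichotomy (k + 1) n with hk | hk | hk
    · refine ⟨fun _ => ?_, fun _ => hlow _ (by omega) hk⟩
      refine he.tailVal_lt_one_of_initial hq hL hg (by rw [hgn]; exact (hub 0).2)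
        (by simpa only [hgn] using h) (n - (k + 1)) _ (by omega) (by omega)
    · rw [hk, hgn]
      exact ⟨fun _ => (hub 0).2, fun _ => (hub 0).1⟩
    · rw [show k + 1 = n + (k + 1 - n) by omega, hgt]
      exact ⟨fun _ => (hub _).2, fun _ => (hub _).1⟩
  · have h1 := hzv 0 N (zero_add N)
    have h2 : q ^ N * tailVal q g 0 =
        q ^ N * (tailVal q (splice (fun _ => 0) N u) 0 + 1) := by linarith
    exact mul_left_cancel₀ (by positivity) h2

lemma IsTrapped.exists_first_lt (hq : 1 < q) (hL : 1 < (m : ℝ) / (q - 1)) (he : IsTrapped m q e)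
    {i : ℕ} (hi : tailVal q e i < 1) : ∃ p, (∀ j < p, e (i + j) = e j) ∧ e (i + p) < e p := by
  have hne : (fun j => e (i + j)) ≠ e := fun h => by
    have : tailVal q e i = tailVal q e 0 :=
      tailVal_congr q fun l => by
        rw [zero_add]
        exact congrFun h l
    rw [he.2.1] at this
    linarith
  obtain ⟨p, h1, h2⟩ := exists_first_diff hne
  exact ⟨p, h1, lt_of_le_of_ne (he.digit_le hq hL h1) h2⟩

lemma IsTrapped.digit_zero (hq : 1 < q) (hqm : (m : ℝ) / 2 + 1 < q) (he : IsTrapped m q e) :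
    m < 2 * e 0 := by
  have h1 := tailVal_step hq he.1 0
  rw [he.2.1] at h1
  have h2 := (he.2.2 (0 + 1)).2
  have : (m : ℝ) < 2 * e 0 := by linarith
  exact_mod_cast this

lemma reflect_lowerPeriodic_bounds (hq : 1 < q) (hL : 1 < (m : ℝ) / (q - 1))
    (he : IsTrapped m q e) {l : ℕ} (hl : SuffixesDominate m e (l + 1)) (h0 : m < 2 * e 0)
    (hl0 : l = 0 → m + 2 ≤ 2 * e 0) (n : ℕ) :
    (m : ℝ) / (q - 1) - 1 < tailVal q (reflect m (lowerPeriodic e (l + 1))) n ∧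
      tailVal q (reflect m (lowerPeriodic e (l + 1))) n < 1 := by
  rw [tailVal_reflect hq (lowerPeriodic_le he.1 _)]
  have := tailVal_lowerPeriodic_bounds hq hL he hl h0 hl0 n
  constructor <;> linarith

/-- The case in which `1` has a periodic expansion. -/
lemma IsTrapped.exists_strict_pair_of_periodic (hq : 1 < q) (hL : 1 < (m : ℝ) / (q - 1))
    (he : IsTrapped m q e) (h0 : m < 2 * e 0) {k : ℕ} (hk : tailVal q e (k + 1) = 1)
    (hkm : e k < m) (hlow : ∀ i, (m : ℝ) / (q - 1) - 1 < tailVal q e i)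
    (hup : ∀ i, 1 ≤ i → i < k + 1 → tailVal q e i < 1) :
    ∃ c d, IsStrict m q c ∧ IsStrict m q d ∧ tailVal q d 0 = tailVal q c 0 + 1 := by
  have hq0 : 0 < q := by linarith
  obtain ⟨j₀, -, hj₀⟩ := Finset.exists_min_image (Finset.range (k + 1)) (tailVal q e)
    ⟨0, by simp⟩
  obtain ⟨l₀, hl₀⟩ := pow_unbounded_of_one_lt
    (2 / (tailVal q e j₀ - ((m : ℝ) / (q - 1) - 1))) hq
  obtain ⟨l', hl', hdom⟩ := he.exists_suffixesDominate hq hL hlow (l₀ + 2)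
  obtain ⟨l, rfl⟩ : ∃ l, l' = l + 1 := ⟨l' - 1, by omega⟩
  have hlp := lowerPeriodic_le he.1 (l + 1)
  have hub := reflect_lowerPeriodic_bounds hq hL he hdom h0 (by omega)
  have htb := tailVal_lowerPeriodic_bounds hq hL he hdom h0 (by omega) 0
  have hsub := tailVal_sub_lowerPeriodic hq he.1 (hdom.last_pos he.1) (zero_add l)
  have hu0 := tailVal_reflect hq hlp 0
  set t := lowerPeriodic e (l + 1)
  set u := reflect m t with hu
  have hum : ∀ i, u i ≤ m := reflect_le m t
  have hclose : ∀ j < k + 1, tailVal q u 0 < tailVal q e j := by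
    intro j hj
    have h1 := hj₀ j (Finset.mem_range.2 hj)
    have h2 : q ^ l₀ ≤ q ^ (l + 1) := pow_le_pow_right₀ hq.le (by omega)
    rw [he.2.1] at hsub
    have h3 := hlow j₀
    rw [div_lt_iff₀ (by linarith)] at hl₀
    have h4 := (he.2.2 (l + 1)).2
    have h5 := htb.1
    have h6 : q ^ (l + 1) * (1 - tailVal q t 0) ≤ 2 := by linarith
    by_contra! hcon
    have h7 : tailVal q e j₀ - ((m : ℝ) / (q - 1) - 1) ≤ 1 - tailVal q t 0 := by linarith
    have h8 : q ^ l₀ * (tailVal q e j₀ - ((m : ℝ) / (q - 1) - 1)) ≤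
        q ^ (l + 1) * (1 - tailVal q t 0) := by
      apply mul_le_mul h2 h7 (by linarith) (by positivity)
    linarith
  let w : ℕ → ℕ := fun i => if i = k then e k + 1 else e i
  have hw : ∀ i, w i ≤ m := by
    intro i
    have := he.1 i
    simp only [w]
    split_ifs <;> omega
  have hg := splice_le hw hum (k + 1)
  have hglt : ∀ i < k, splice w (k + 1) u i = e i := fun i hi => by
    rw [splice_of_lt (by omega)]
    exact if_neg (by omega)
  have hgk : splice w (k + 1) u k = e k + 1 := by
    rw [splice_of_lt (by omega)]
    exact if_pos rfl
  have hgu : ∀ i, splice w (k + 1) u (k + 1 + i) = u i := fun i => splice_add _ _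
  have hgv : tailVal q (splice w (k + 1) u) (k + 1) = tailVal q u 0 :=
    tailVal_splice_add q (k + 1) 0
  set g := splice w (k + 1) u
  have hdiff : ∀ i j, i + j = k → q ^ (j + 1) * (tailVal q g i - tailVal q e i) = tailVal q u 0 := by
    intro i j hij
    have h1 := tailVal_sub_of_agree hq hg he.1 (i := i) (j := i) j
      (fun l hl => hglt _ (by omega))
    have h2 := tailVal_step hq hg k
    have h3 := tailVal_step hq he.1 k
    rw [hij] at h1
    rw [hgk, hgv] at h2
    rw [hk] at h3
    rw [pow_succ, mul_comm (q ^ j), mul_assoc, h1, mul_sub, h2, h3]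
    push_cast
    ring
  refine exists_strict_pair_of_initial (N := k + 1) hq hL he hum hub hg hgu
    (fun i hi hik => ?_) (fun i hi hik => ?_) ?_
  · obtain ⟨p, hp1, hp2⟩ := he.exists_first_lt hq hL (hup i hi hik)
    have hpk : i + p ≤ k := by
      by_contra! hcon
      have h1 := tailVal_sub_of_agree hq he.1 he.1 (i := i) (j := 0) (k + 1 - i)
        (fun j hj => by rw [zero_add]; exact hp1 j (by omega))
      rw [show i + (k + 1 - i) = k + 1 by omega, hk, he.2.1] at h1
      have h2 := (he.2.2 (0 + (k + 1 - i))).2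
      have h3 : q ^ (k + 1 - i) * (tailVal q e i - 1) < 0 :=
        mul_neg_of_pos_of_neg (by positivity) (by linarith [hup i hi hik])
      linarith
    have hag : ∀ j < p, g (i + j) = e j := fun j hj => by
      rw [hglt _ (by omega)]
      exact hp1 j hj
    rcases hpk.lt_or_eq with h | h
    · exact Or.inl ⟨p, by omega, hag, by rwa [hglt _ h]⟩
    · rcases (show e k + 1 ≤ e p by rw [← h]; exact hp2).lt_or_eq with h' | h'
      · exact Or.inl ⟨p, by omega, hag, by rwa [h, hgk]⟩
      · refine Or.inr ⟨fun j hj => ?_, hclose _ (by omega)⟩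
        rcases (show j ≤ p by omega).lt_or_eq with h'' | h''
        · exact hag j h''
        · rw [h'', h, hgk, h']
  · obtain ⟨j, hj⟩ := Nat.exists_eq_add_of_le (Nat.lt_succ_iff.1 hik)
    have h1 := hdiff i j hj.symm
    by_contra! hcon
    have h2 : q ^ (j + 1) * (tailVal q g i - tailVal q e i) ≤ 0 :=
      mul_nonpos_of_nonneg_of_nonpos (by positivity) (by linarith [hlow i])
    linarith [(hub 0).1]
  · have := hdiff 0 k (zero_add k)
    rwa [he.2.1] at this

/-- The case in which a tail of the expansion of `1` is its reflection. -/
lemma IsTrapped.exists_strict_pair_of_antiperiodic (hq : 1 < q) (hL : 1 < (m : ℝ) / (q - 1))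
    (hL2 : (m : ℝ) / (q - 1) < 2)
    (he : IsTrapped m q e) (h0 : m < 2 * e 0) {k : ℕ}
    (hk : tailVal q e (k + 1) = (m : ℝ) / (q - 1) - 1) (hk0 : k = 0 → m + 2 ≤ 2 * e 0)
    (hlow : ∀ i, i < k + 1 → (m : ℝ) / (q - 1) - 1 < tailVal q e i)
    (hup : ∀ i, 1 ≤ i → i < k + 1 → tailVal q e i < 1) :
    ∃ c d, IsStrict m q c ∧ IsStrict m q d ∧ tailVal q d 0 = tailVal q c 0 + 1 := by
  have hq0 : 0 < q := by linarith
  have hdom : SuffixesDominate m e (k + 1) := by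
    intro i hi
    obtain ⟨p, hp1, hp2⟩ := he.exists_dominating hq hL (hlow i hi)
    rcases lt_or_ge (i + p) (k + 1) with h | h
    · exact ⟨p, h, hp1, hp2⟩
    rcases Nat.eq_zero_or_pos i with rfl | hi0
    · exact ⟨0, by omega, by simp, by simpa [two_mul] using h0⟩
    exfalso
    have h1 := tailVal_sub_of_agree hq he.1 (reflect_le m e) (i := i) (j := 0) (k + 1 - i)
      (fun j hj => by
        have := hp1 j (by omega)
        simp only [reflect, zero_add]
        omega)
    rw [show i + (k + 1 - i) = k + 1 by omega, hk, tailVal_reflect hq he.1,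
      tailVal_reflect hq he.1, he.2.1, zero_add] at h1
    have h2 := hup (k + 1 - i) (by omega) (by omega)
    have h3 : 0 < q ^ (k + 1 - i) * (tailVal q e i - ((m : ℝ) / (q - 1) - 1)) :=
      mul_pos (by positivity) (by linarith [hlow i hi])
    linarith
  have hlp := lowerPeriodic_le he.1 (k + 1)
  have hub := reflect_lowerPeriodic_bounds hq hL he hdom h0 hk0
  have hsub := tailVal_sub_lowerPeriodic hq he.1 (hdom.last_pos he.1) (zero_add k)
  have hu0 := tailVal_reflect hq hlp 0
  have hlplt : ∀ j < k, lowerPeriodic e (k + 1) j = e j := fun j hj =>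
    lowerPeriodic_of_lt (by omega)
  set t := lowerPeriodic e (k + 1)
  set u := reflect m t with hu
  have hum : ∀ i, u i ≤ m := reflect_le m t
  have hg := splice_le he.1 hum (k + 1)
  have hglt : ∀ i < k + 1, splice e (k + 1) u i = e i := fun i hi => splice_of_lt hi
  have hgu : ∀ i, splice e (k + 1) u (k + 1 + i) = u i := fun i => splice_add _ _
  have hgv : tailVal q (splice e (k + 1) u) (k + 1) = tailVal q u 0 :=
    tailVal_splice_add q (k + 1) 0
  set g := splice e (k + 1) u
  have hdiff : ∀ i j, i + j = k + 1 → q ^ j * (tailVal q g i - tailVal q e i) =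
      tailVal q u 0 - ((m : ℝ) / (q - 1) - 1) := by
    intro i j hij
    have h1 := tailVal_sub_of_agree hq hg he.1 (i := i) (j := i) j
      (fun l hl => hglt _ (by omega))
    rwa [hij, hgv, hk] at h1
  refine exists_strict_pair_of_initial (N := (k + 1) + (k + 1)) hq hL he hum hub hg hgu
    (fun i hi hik => ?_) (fun i hi hik => ?_) ?_
  · obtain ⟨p, hp1, hp2⟩ := he.exists_first_lt hq hL (hup i hi hik)
    rcases lt_or_ge (i + p) (k + 1) with h | h
    · refine Or.inl ⟨p, h, fun j hj => ?_, by rwa [hglt _ h]⟩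
      rw [hglt _ (by omega)]
      exact hp1 j hj
    · refine Or.inr ⟨fun j hj => ?_, ?_⟩
      · rw [hglt _ (by omega)]
        exact hp1 j (by omega)
      · obtain ⟨p', h1, h2, h3⟩ := hdom (k + 1 - i) (by omega)
        refine tailVal_lt_of_agree hq hum he.1 (p := p') (fun j hj => ?_) ?_ ?_
        · have := h2 j hj
          rw [zero_add, hu, reflect, hlplt j (by omega)]
          omega
        · have := he.1 p'
          rw [zero_add, hu, reflect, hlplt p' (by omega)]
          omega
        · linarith [(hub (0 + p' + 1)).2, (he.2.2 (k + 1 - i + p' + 1)).1]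
  · have h1 := hdiff i (k + 1 - i) (by omega)
    by_contra! hcon
    have h2 : q ^ (k + 1 - i) * (tailVal q g i - tailVal q e i) ≤ 0 :=
      mul_nonpos_of_nonneg_of_nonpos (by positivity) (by linarith [hlow i hik])
    linarith [(hub 0).1]
  · have h1 := hdiff 0 (k + 1) (zero_add _)
    rw [he.2.1] at h1 hsub
    rw [pow_add, mul_assoc, h1]
    rw [hk] at hsub
    have h2 : tailVal q u 0 - ((m : ℝ) / (q - 1) - 1) = 1 - tailVal q t 0 := by linarith
    rw [h2, hsub]
    linarith

lemma isStrict_zero (m : ℕ) (q : ℝ) : IsStrict m q fun _ => 0 := by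
  refine ⟨fun _ => Nat.zero_le m, fun n => ⟨fun _ => ?_, fun h => absurd h (lt_irrefl 0)⟩⟩
  simp [tailVal]

/-- A weak expansion of `1` yields two strict sequences whose values differ by `1`. -/
lemma exists_strict_pair_of_weak_one (hq : 1 < q) (hL : 1 < (m : ℝ) / (q - 1))
    (hqm : (m : ℝ) / 2 + 1 < q)
    (hG : ∀ d : ℕ, (d : ℝ) = q - ((m : ℝ) / (q - 1) - 1) → m + 2 ≤ 2 * d)
    (he : IsWeak m q e) (h1 : tailVal q e 0 = 1) :
    ∃ c d, IsStrict m q c ∧ IsStrict m q d ∧ tailVal q d 0 = tailVal q c 0 + 1 := by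
  classical
  have hL2 : (m : ℝ) / (q - 1) < 2 := by
    rw [div_lt_iff₀ (by linarith)]
    linarith
  have ht := he.isTrapped hq hL2 h1
  have h0 := ht.digit_zero hq hqm
  by_cases hs : IsStrict m q e
  · exact ⟨_, e, isStrict_zero m q, hs, by rw [h1]; simp [tailVal]⟩
  have hex : ∃ n, tailVal q e (n + 1) = 1 ∨ tailVal q e (n + 1) = (m : ℝ) / (q - 1) - 1 := by
    by_contra! hcon
    refine hs ⟨he.1, fun n => ⟨fun _ => ?_, fun _ => ?_⟩⟩
    · exact lt_of_le_of_ne (ht.2.2 _).2 (hcon n).1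
    · exact lt_of_le_of_ne (ht.2.2 _).1 (hcon n).2.symm
  have hspec := Nat.find_spec hex
  have hmin := fun n hn => Nat.find_min hex (m := n) hn
  set k := Nat.find hex
  have hmin' : ∀ i, 1 ≤ i → i < k + 1 →
      (m : ℝ) / (q - 1) - 1 < tailVal q e i ∧ tailVal q e i < 1 := by
    intro i hi hik
    obtain ⟨n, rfl⟩ : ∃ n, i = n + 1 := ⟨i - 1, by omega⟩
    have := hmin n (by omega)
    push Not at this
    exact ⟨lt_of_le_of_ne (ht.2.2 _).1 this.2.symm, lt_of_le_of_ne (ht.2.2 _).2 this.1⟩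
  have hlow : ∀ i, i < k + 1 → (m : ℝ) / (q - 1) - 1 < tailVal q e i := by
    intro i hik
    rcases Nat.eq_zero_or_pos i with rfl | hi
    · rw [h1]; linarith
    · exact (hmin' i hi hik).1
  rcases hspec with hk | hk
  · have hkm : e k < m := by
      refine lt_of_le_of_ne (he.1 k) fun h => ?_
      have h2 := tailVal_step hq he.1 k
      rw [h, hk] at h2
      have h3 := (ht.2.2 k).2
      rw [lt_div_iff₀ (by linarith)] at hL
      nlinarith
    refine ht.exists_strict_pair_of_periodic hq hL h0 hk hkm (fun i => ?_)
      fun i hi hik => (hmin' i hi hik).2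
    have hper : ∀ i, tailVal q e (k + 1 + i) = tailVal q e i := by
      have heq : ∀ j, e (k + 1 + j) = e j := by
        by_contra hcon
        have hne : (fun j => e (k + 1 + j)) ≠ e := fun h => hcon fun j => congrFun h j
        obtain ⟨p, hp1, hp2⟩ := exists_first_diff hne
        have hp3 := lt_of_le_of_ne (ht.digit_le hq hL hp1) hp2
        have := tailVal_lt_of_agree hq he.1 he.1 (i := k + 1) (j := 0) (p := p)
          (by simpa using hp1) (by simpa using hp3)
          (by linarith [(ht.2.2 (k + 1 + p + 1)).2, (ht.2.2 (0 + p + 1)).1])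
        rw [hk, h1] at this
        exact lt_irrefl _ this
      intro i
      exact tailVal_congr q fun l => by rw [add_assoc, heq]
    induction i using Nat.strong_induction_on with
    | _ i ih =>
      rcases lt_or_ge i (k + 1) with h | h
      · exact hlow i h
      · rw [show i = k + 1 + (i - (k + 1)) by omega, hper]
        exact ih _ (by omega)
  · refine ht.exists_strict_pair_of_antiperiodic hq hL hL2 h0 hk (fun hk0 => ?_) hlow
      fun i hi hik => (hmin' i hi hik).2
    refine hG _ ?_
    have h2 := tailVal_step hq he.1 0
    rw [hk0] at hk
    rw [h1, hk] at h2
    linarith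

/-- Weak pairs can be replaced by strict pairs. -/
lemma exists_strict_pair_of_weak_pair (hq : 1 < q) (hL : 1 < (m : ℝ) / (q - 1))
    (hqm : (m : ℝ) / 2 + 1 < q)
    (hG : ∀ d : ℕ, (d : ℝ) = q - ((m : ℝ) / (q - 1) - 1) → m + 2 ≤ 2 * d)
    {c d : ℕ → ℕ} (hc : IsWeak m q c) (hd : IsWeak m q d)
    (hv : tailVal q d 0 = tailVal q c 0 + 1) :
    ∃ c d, IsStrict m q c ∧ IsStrict m q d ∧ tailVal q d 0 = tailVal q c 0 + 1 := by
  by_cases hone : ∃ e, IsWeak m q e ∧ tailVal q e 0 = 1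
  · obtain ⟨e, he, h1⟩ := hone
    exact exists_strict_pair_of_weak_one hq hL hqm hG he h1
  have key : ∀ {a : ℕ → ℕ}, IsWeak m q a → IsStrict m q a := by
    intro a ha
    refine ⟨ha.1, fun n => ⟨fun h => ?_, fun h => ?_⟩⟩
    · refine lt_of_le_of_ne ((ha.2 n).1 h) fun h1 => hone ⟨_, ha.shift (n + 1), ?_⟩
      rw [tailVal_shift, add_zero, h1]
    · refine lt_of_le_of_ne ((ha.2 n).2 h) fun h1 =>
        hone ⟨_, (ha.shift (n + 1)).reflect hq, ?_⟩
      rw [tailVal_reflect hq (ha.shift (n + 1)).1, tailVal_shift, add_zero, ← h1]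
      ring
  exact ⟨c, d, key hc, key hd, hv⟩

end Pairs


/-- All tails of `e` have value in the open interval `(m/(q-1) - 1, 1)`. -/
def IsOpenTrapped (m : ℕ) (q : ℝ) (e : ℕ → ℕ) : Prop :=
  (∀ i, e i ≤ m) ∧ ∀ n, (m : ℝ) / (q - 1) - 1 < tailVal q e n ∧ tailVal q e n < 1

/-- `y < 1` is the value of a strict sequence. -/
def IsLow (m : ℕ) (q : ℝ) (y : ℝ) : Prop :=
  y < 1 ∧ ∃ c, IsStrict m q c ∧ tailVal q c 0 = y

section LowValues

variable {m : ℕ} {q : ℝ} {c e : ℕ → ℕ}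

lemma IsStrict.tailVal_lt_one (hq : 1 < q) (hc : IsStrict m q c) (h : tailVal q c 0 < 1) (n : ℕ) :
    tailVal q c n < 1 := by
  induction n with
  | zero => exact h
  | succ n ih =>
    rcases (hc.1 n).lt_or_eq with h1 | h1
    · exact (hc.2 n).1 h1
    · have hs := tailVal_step hq hc.1 n
      have hle := tailVal_le hq hc.1 n
      rw [le_div_iff₀ (by linarith)] at hle
      rw [h1] at hs
      linarith

lemma IsStrict.isOpenTrapped (hq : 1 < q) (hqm : q ≤ m + 1) (hc : IsStrict m q c)
    (h : tailVal q c 0 < 1) {i : ℕ} (hi : 0 < c i) :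
    IsOpenTrapped m q fun j => c (i + 1 + j) := by
  refine ⟨fun j => hc.1 _, fun n => ?_⟩
  rw [tailVal_shift]
  refine ⟨?_, hc.tailVal_lt_one hq h _⟩
  have hL : 0 ≤ (m : ℝ) / (q - 1) - 1 := by
    have : 1 ≤ (m : ℝ) / (q - 1) := by
      rw [le_div_iff₀ (by linarith)]
      linarith
    linarith
  induction n with
  | zero => exact (hc.2 i).2 hi
  | succ n ih =>
    rcases Nat.eq_zero_or_pos (c (i + 1 + n)) with h1 | h1
    · have hs := tailVal_step hq hc.1 (i + 1 + n)
      rw [h1, Nat.cast_zero, zero_add] at hs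
      rw [← add_assoc, ← hs]
      nlinarith
    · exact (hc.2 _).2 h1

lemma IsOpenTrapped.reflect (hq : 1 < q) (he : IsOpenTrapped m q e) :
    IsOpenTrapped m q (reflect m e) := by
  refine ⟨reflect_le m e, fun n => ?_⟩
  rw [tailVal_reflect hq he.1]
  constructor <;> linarith [(he.2 n).1, (he.2 n).2]

lemma IsOpenTrapped.digit_lt (hq : 1 < q) (he : IsOpenTrapped m q e) (n : ℕ) :
    (e n : ℝ) < q - ((m : ℝ) / (q - 1) - 1) := by
  have hs := tailVal_step hq he.1 n
  nlinarith [(he.2 n).2, (he.2 (n + 1)).1]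

lemma IsOpenTrapped.lt_digit (hq : 1 < q) (he : IsOpenTrapped m q e) (n : ℕ) :
    (m : ℝ) - (q - ((m : ℝ) / (q - 1) - 1)) < e n := by
  have := (he.reflect hq).digit_lt hq n
  rw [cast_reflect he.1] at this
  linarith

lemma IsLow.nonneg (hq : 1 < q) {y : ℝ} (hy : IsLow m q y) : 0 ≤ y := by
  obtain ⟨-, c, -, rfl⟩ := hy
  exact tailVal_nonneg hq c 0

/-- Removing the first digit of a low value leaves a low value or the value of a trapped
sequence. -/
lemma IsLow.cases (hq : 1 < q) (hqm : q ≤ m + 1) {y : ℝ} (hy : IsLow m q y) :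
    IsLow m q (q * y) ∨
      ∃ d : ℕ, ∃ e, 0 < d ∧ IsOpenTrapped m q e ∧ q * y = d + tailVal q e 0 := by
  obtain ⟨h1, c, hc, rfl⟩ := hy
  have hs := tailVal_step hq hc.1 0
  rcases Nat.eq_zero_or_pos (c 0) with h | h
  · left
    rw [h, Nat.cast_zero, zero_add] at hs
    rw [hs]
    exact ⟨hc.tailVal_lt_one hq h1 _, _, hc.shift 1, tailVal_shift q c 1 0⟩
  · right
    refine ⟨c 0, _, h, hc.isOpenTrapped hq hqm h1 h, ?_⟩
    rw [hs, tailVal_shift]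

lemma IsLow.induction (hq : 1 < q) (hqm : q ≤ m + 1) {Q : ℝ → Prop} (h0 : Q 0)
    (hd : ∀ (d : ℕ) (e : ℕ → ℕ) (y : ℝ), 0 < d → IsOpenTrapped m q e → y < 1 →
      q * y = d + tailVal q e 0 → Q y)
    (hz : ∀ y, IsLow m q (q * y) → Q (q * y) → Q y) {y : ℝ} (hy : IsLow m q y) : Q y := by
  obtain ⟨h1, c, hc, rfl⟩ := hy
  by_cases hne : ∃ n, 0 < c n
  · obtain ⟨n, hn⟩ := hne
    induction n generalizing c with
    | zero =>
      refine hd (c 0) _ _ hn (hc.isOpenTrapped hq hqm h1 hn) h1 ?_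
      rw [tailVal_step hq hc.1 0, tailVal_shift]
    | succ n ih =>
      have hs := tailVal_step hq hc.1 0
      rcases Nat.eq_zero_or_pos (c 0) with h | h
      · rw [h, Nat.cast_zero, zero_add] at hs
        have h2 : tailVal q c (0 + 1) < 1 := hc.tailVal_lt_one hq h1 _
        have e1 : tailVal q (fun i => c (1 + i)) 0 = tailVal q c (0 + 1) := tailVal_shift q c 1 0
        refine hz _ ?_ ?_
        · rw [hs]
          exact ⟨h2, _, hc.shift 1, e1⟩
        · rw [hs, ← e1]
          exact ih _ (hc.shift 1) (by rw [e1]; exact h2) (by rwa [add_comm 1 n])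
      · refine hd (c 0) _ _ h (hc.isOpenTrapped hq hqm h1 h) h1 ?_
        rw [hs, tailVal_shift]
  · push Not at hne
    have : tailVal q c 0 = 0 := by simp [tailVal, fun i => Nat.le_zero.1 (hne i)]
    rwa [this]

/-- Strict pairs do not exist when `m/(q-1) ≥ 2`. -/
lemma lt_two_of_strict_pair (hm : 0 < m) (hq : 1 < q) (hqm : q ≤ m + 1) {c d : ℕ → ℕ}
    (hc : IsStrict m q c) (hd : IsStrict m q d) (hv : tailVal q d 0 = tailVal q c 0 + 1) :
    (m : ℝ) / (q - 1) < 2 := by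
  by_contra! hL
  have key : ∀ {a : ℕ → ℕ}, IsStrict m q a → tailVal q a 0 ≤ (m : ℝ) / (q - 1) - 1 →
      tailVal q a 0 = 0 := by
    intro a ha hle
    have hdig : ∀ n, a n = 0 ∨ a n = m := by
      intro n
      by_contra! h
      have h1 := (ha.2 n).1 (lt_of_le_of_ne (ha.1 n) h.2)
      have h2 := (ha.2 n).2 (Nat.pos_of_ne_zero h.1)
      linarith
    have hqL : q * ((m : ℝ) / (q - 1)) = m + (m : ℝ) / (q - 1) := by
      have : q - 1 ≠ 0 := by linarith
      field_simp
      ring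
    have hz : ∀ n, a n = 0 := by
      intro n
      induction n with
      | zero =>
        refine (hdig 0).resolve_right fun h => ?_
        have h1 := (ha.2 0).2 (by omega)
        have h2 := tailVal_step hq ha.1 0
        rw [h] at h2
        nlinarith
      | succ n ih =>
        refine (hdig (n + 1)).resolve_right fun h => ?_
        have h1 := (ha.2 (n + 1)).2 (by omega)
        have h2 := tailVal_step hq ha.1 (n + 1)
        have h3 := (ha.2 n).1 (by omega)
        rw [h] at h2
        nlinarith
    simp [tailVal, hz]
  have h1 := tailVal_reflect hq hd.1 0
  have h2 := tailVal_nonneg hq c 0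
  have h3 := tailVal_nonneg hq (reflect m d) 0
  have h4 := key hc (by linarith)
  have h5 := key (hd.reflect hq) (by linarith)
  linarith

/-- A strict pair splits `m/(q-1) - 1` into two low values. -/
lemma exists_low_pair (hm : 0 < m) (hq : 1 < q) (hqm : q ≤ m + 1) {c d : ℕ → ℕ}
    (hc : IsStrict m q c) (hd : IsStrict m q d) (hv : tailVal q d 0 = tailVal q c 0 + 1) :
    ∃ y z, IsLow m q y ∧ IsLow m q z ∧ y + z = (m : ℝ) / (q - 1) - 1 := by
  have hL := lt_two_of_strict_pair hm hq hqm hc hd hv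
  have h1 := tailVal_reflect hq hd.1 0
  have h2 := tailVal_nonneg hq c 0
  have h3 := tailVal_nonneg hq (reflect m d) 0
  exact ⟨_, _, ⟨by linarith, c, hc, rfl⟩, ⟨by linarith, _, hd.reflect hq, rfl⟩, by linarith⟩

end LowValues

section Even

variable {k : ℕ} {q : ℝ}

lemma even_bound (hk : 0 < k) (hq : 1 < q) (hqm : q ≤ (2 * k : ℕ) + 1)
    (hL : ((2 * k : ℕ) : ℝ) / (q - 1) < 2) {y z : ℝ} (hy : IsLow (2 * k) q y)
    (hz : IsLow (2 * k) q z) (hyz : y + z = ((2 * k : ℕ) : ℝ) / (q - 1) - 1) :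
    1 ≤ q ^ 2 - (k + 1) * q := by
  by_contra! hg
  have hk1 : (1 : ℝ) ≤ k := by exact_mod_cast hk
  have hq1 : 0 < q - 1 := by linarith
  obtain ⟨M, hM⟩ : ∃ M, M = (k : ℝ) / (q - 1) := ⟨_, rfl⟩
  have hLM : ((2 * k : ℕ) : ℝ) / (q - 1) = 2 * M := by rw [hM]; push_cast; ring
  rw [hLM] at hL hyz
  have hqM : q * M = k + M := by rw [hM]; field_simp; ring
  have hM0 : 0 < M := by rw [hM]; positivity
  have hqk : (k : ℝ) + 1 < q := by nlinarith
  have htrap : ∀ e, IsOpenTrapped (2 * k) q e → tailVal q e 0 = M := by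
    intro e he
    have hdig : ∀ n, e n = k := by
      intro n
      have hkey : q - (2 * M - 1) ≤ k + 1 := by
        by_contra! hcon
        nlinarith
      have h1 := he.digit_lt hq n
      have h2 := he.lt_digit hq n
      rw [hLM] at h1 h2
      push_cast at h2
      have h3 : (e n : ℝ) < (k + 1 : ℕ) := by push_cast; linarith
      have h4 : (k : ℝ) < (e n + 1 : ℕ) := by push_cast; linarith
      rw [Nat.cast_lt] at h3 h4
      omega
    refine eq_tailVal (m := 2 * k) (x := fun _ => M) (C := M) hq he.1
      (fun n => (abs_of_pos hM0).le) (fun n => ?_) 0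
    rw [hdig, hqM]
  have hlow : ∀ {y}, IsLow (2 * k) q y → y = M ∨ q * y ≤ q * M - 1 := by
    intro y hy
    refine IsLow.induction (Q := fun y => y = M ∨ q * y ≤ q * M - 1) hq hqm (Or.inr ?_) ?_ ?_ hy
    · linarith
    · intro d e y _ he hy1 hyd
      rw [htrap e he] at hyd
      have hdk : (d : ℝ) < (k + 1 : ℕ) := by
        push_cast
        by_contra! hcon
        have : k + 1 + M < q := by nlinarith
        nlinarith
      rw [Nat.cast_lt] at hdk
      rcases (Nat.lt_succ_iff.1 hdk).lt_or_eq with h | h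
      · right
        have : (d : ℝ) + 1 ≤ k := by exact_mod_cast h
        linarith
      · left
        rw [h] at hyd
        exact mul_left_cancel₀ (by linarith : q ≠ 0) (by linarith)
    · intro y _ h
      right
      rcases h with h | h
      · linarith
      · have : q * y ≤ M := by
          have : q * (q * y) ≤ q * M := by linarith
          exact le_of_mul_le_mul_left this (by linarith)
        linarith
  have hcases : ∀ {y}, IsLow (2 * k) q y →
      (∃ d : ℕ, q * y = d + M) ∨ q * (q * y) ≤ q * M - 1 := by
    intro y hy
    rcases hy.cases hq hqm with h | ⟨d, e, _, he, h⟩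
    · rcases hlow h with h | h
      · exact Or.inl ⟨0, by rw [h]; simp⟩
      · exact Or.inr h
    · exact Or.inl ⟨d, by rw [h, htrap e he]⟩
  have hsmall : ∀ {y z}, IsLow (2 * k) q y → IsLow (2 * k) q z → y + z = 2 * M - 1 →
      ¬ q * (q * z) ≤ q * M - 1 := by
    intro y z hy hz hyz h
    have hz0 := hz.nonneg hq
    rcases hlow hy with h1 | h1
    · linarith
    · have h2 : q * (q * y) ≤ q * (q * M - 1) := by gcongr
      have h3 : q * (q * y) + q * (q * z) = q * (q * (2 * M - 1)) := by rw [← hyz]; ring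
      nlinarith
  rcases hcases hy with ⟨d, h1⟩ | h1
  · rcases hcases hz with ⟨d', h2⟩ | h2
    · have h3 : q * y + q * z = q * (2 * M - 1) := by rw [← hyz]; ring
      have h4 : q = 2 * k - d - d' := by linarith
      have h5 : q < k + 2 := by nlinarith
      rw [h4] at h5 hqk
      have h6 : (((k + 1 + d + d' : ℕ)) : ℝ) < (2 * k : ℕ) := by push_cast; linarith
      have h7 : ((2 * k : ℕ) : ℝ) < (k + 2 + d + d' : ℕ) := by push_cast; linarith
      rw [Nat.cast_lt] at h6 h7
      omega
    · exact hsmall hy hz hyz h2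
  · exact hsmall hz hy (by linarith) h1

end Even

section Odd

variable {k : ℕ} {q : ℝ}

lemma odd_pos (hq : 1 < q) (hqm : q ≤ (2 * k + 1 : ℕ) + 1)
    {y z : ℝ} (hy : IsLow (2 * k + 1) q y)
    (hz : IsLow (2 * k + 1) q z) (hyz : y + z = ((2 * k + 1 : ℕ) : ℝ) / (q - 1) - 1) :
    0 < q ^ 2 - (k + 1) * q - (k + 1) := by
  by_contra! hf
  have hq1 : 0 < q - 1 := by linarith
  obtain ⟨A, hA⟩ : ∃ A, A = ((2 * k + 1 : ℕ) : ℝ) / (q - 1) := ⟨_, rfl⟩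
  have hqA : (q - 1) * A = 2 * k + 1 := by
    rw [hA]
    push_cast
    field_simp
  rw [← hA] at hyz
  have htrap : ∀ e, ¬ IsOpenTrapped (2 * k + 1) q e := by
    intro e he
    have h1 := he.digit_lt hq 0
    have h2 := he.lt_digit hq 0
    rw [← hA] at h1 h2
    have hkey : q - (A - 1) ≤ k + 1 := by
      by_contra! hcon
      nlinarith
    have h3 : (e 0 : ℝ) < (k + 1 : ℕ) := by push_cast; linarith
    have h4 : (k : ℝ) < e 0 := by push_cast at h2; linarith
    rw [Nat.cast_lt] at h3 h4
    omega
  have hlow : ∀ {y}, IsLow (2 * k + 1) q y → y = 0 := fun hy =>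
    IsLow.induction (Q := fun y => y = 0) hq hqm rfl (fun _ e _ _ he => absurd he (htrap e))
      (fun y _ h => (mul_eq_zero.1 h).resolve_left (by linarith)) hy
  rw [hlow hy, hlow hz] at hyz
  have hA1 : A = 1 := by linarith
  rw [hA1] at hqA
  have hk0 : (0 : ℝ) ≤ k := Nat.cast_nonneg k
  have : q = 2 * k + 2 := by linarith
  rw [this] at hf
  nlinarith

/-- Trapped sequences for odd `m` alternate between the digits `k` and `k + 1`. -/
lemma IsOpenTrapped.add_digit_succ (hq : 1 < q)
    (hd : q - (((2 * k + 1 : ℕ) : ℝ) / (q - 1) - 1) ≤ k + 2)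
    (hf : q * (q - (k + 1)) - (k + 1) ≤ ((2 * k + 1 : ℕ) : ℝ) / (q - 1) - 1)
    {e : ℕ → ℕ} (he : IsOpenTrapped (2 * k + 1) q e) (n : ℕ) :
    (e n = k ∨ e n = k + 1) ∧ e n + e (n + 1) = 2 * k + 1 := by
  have hdig : ∀ {e : ℕ → ℕ}, IsOpenTrapped (2 * k + 1) q e → ∀ n, e n = k ∨ e n = k + 1 := by
    intro e he n
    have h1 := he.digit_lt hq n
    have h2 := he.lt_digit hq n
    have h3 : (e n : ℝ) < (k + 2 : ℕ) := by push_cast; linarith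
    have h4 : (k : ℝ) < (e n + 1 : ℕ) := by push_cast at h2 hd ⊢; linarith
    rw [Nat.cast_lt] at h3 h4
    omega
  have hno : ∀ {e : ℕ → ℕ}, IsOpenTrapped (2 * k + 1) q e → ∀ n,
      ¬ (e n = k + 1 ∧ e (n + 1) = k + 1) := by
    rintro e he n ⟨h1, h2⟩
    have h3 := tailVal_step hq he.1 n
    have h4 := tailVal_step hq he.1 (n + 1)
    rw [h1] at h3
    rw [h2] at h4
    push_cast at h3 h4
    have h5 := (he.2 n).2
    have h6 := (he.2 (n + 1 + 1)).1
    have h7 : tailVal q e (n + 1) < q - (k + 1) := by nlinarith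
    have h8 : q * tailVal q e (n + 1) < q * (q - (k + 1)) :=
      mul_lt_mul_of_pos_left h7 (by linarith)
    linarith
  refine ⟨hdig he n, ?_⟩
  have h1 := hno he n
  have h2 := hno (he.reflect hq) n
  have h3 := hdig he n
  have h4 := hdig he (n + 1)
  simp only [_root_.reflect] at h2
  omega

set_option maxHeartbeats 400000 in
lemma odd_bound (hq : 1 < q) (hqm : q ≤ (2 * k + 1 : ℕ) + 1)
    {y z : ℝ} (hy : IsLow (2 * k + 1) q y)
    (hz : IsLow (2 * k + 1) q z) (hyz : y + z = ((2 * k + 1 : ℕ) : ℝ) / (q - 1) - 1) :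
    1 ≤ (q ^ 2 - (k + 1) * q - (k + 1)) * q * (q + 1) := by
  have hf := odd_pos hq hqm hy hz hyz
  by_contra! hlt
  have hk0 : (0 : ℝ) ≤ k := Nat.cast_nonneg k
  have hq1 : 0 < q - 1 := by linarith
  have hq0 : 0 < q := by linarith
  have hq16 : 1.6 < q := by nlinarith
  obtain ⟨D, hD⟩ : ∃ D, D = 1 / (q + 1) := ⟨_, rfl⟩
  have hDq : q * D = 1 - D := by rw [hD]; field_simp; ring
  have hD0 : 0 < D := by rw [hD]; positivity
  have hD4 : D < 0.385 := by nlinarith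
  obtain ⟨η, hη⟩ : ∃ η, η = (q ^ 2 - (k + 1) * q - (k + 1)) / (q ^ 2 - 1) := ⟨_, rfl⟩
  have hqq : 0 < q ^ 2 - 1 := by nlinarith
  have hη0 : 0 < η := by rw [hη]; positivity
  have hηf : η * (q ^ 2 - 1) = q ^ 2 - (k + 1) * q - (k + 1) := by rw [hη]; field_simp
  -- `k` in terms of `q`, `D`, `η`
  have hk : (k : ℝ) = q - 2 + D - (q - 1) * η := by
    have : (q + 1) * k = (q + 1) * (q - 2 + D - (q - 1) * η) := by linarith
    exact mul_left_cancel₀ (by linarith : q + 1 ≠ 0) this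
  have hA : ((2 * k + 1 : ℕ) : ℝ) / (q - 1) = 2 - D - 2 * η := by
    rw [div_eq_iff (by linarith)]
    push_cast
    rw [hk]
    linarith
  have hb : η * (q ^ 2 - 1) * q < D := by
    rw [hηf, hD, lt_div_iff₀ (by linarith)]
    exact hlt
  have hb1 : q * (q - 1) * η < D ^ 2 := by
    have h : (q + 1) * D ^ 2 = D * (q * D + D) := by ring
    rw [hDq, sub_add_cancel, mul_one] at h
    have : (q + 1) * (q * (q - 1) * η) < (q + 1) * D ^ 2 := by linarith
    exact lt_of_mul_lt_mul_left this (by linarith)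
  have hqη0 : 0 < q * η := by positivity
  have hqη : 1.56 * (q * η) < D := by
    have : 1.56 * (q * η) ≤ (q ^ 2 - 1) * (q * η) :=
      mul_le_mul_of_nonneg_right (by nlinarith) hqη0.le
    linarith
  have hη1 : η < 0.155 := by
    have : 1.6 * η ≤ q * η := by gcongr
    linarith
  have hqη1 : (q - 1) * η < D := by linarith
  have hf4 : η * (q ^ 2 - 1) < 0.25 := by
    have : η * (q ^ 2 - 1) * 1.6 ≤ η * (q ^ 2 - 1) * q := by gcongr
    linarith
  have hD2 : D ^ 2 < 0.385 ^ 2 := by gcongr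
  have hηqq : 0 < η * (q ^ 2 - 1) := by positivity
  rw [hA] at hyz
  have hpair : ∀ {e : ℕ → ℕ}, IsOpenTrapped (2 * k + 1) q e →
      tailVal q e 0 = 1 - η ∨ tailVal q e 0 = 1 - D - η := by
    intro e he
    have halt := fun n => he.add_digit_succ hq (by rw [hA]; linarith)
      (by rw [hA]; linarith) n
    have hval : ∀ n, tailVal q e n = if e n = k + 1 then 1 - η else 1 - D - η := by
      refine eq_tailVal (m := 2 * k + 1) (C := 1) hq he.1 (fun n => ?_) (fun n => ?_)
      · rw [abs_le]
        split_ifs <;> constructor <;> linarith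
      · obtain ⟨h1, h2⟩ := halt n
        rcases h1 with h1 | h1
        · have h3 : e (n + 1) = k + 1 := by omega
          rw [h1, h3, if_neg (by omega), if_pos rfl, hk]
          linarith
        · have h3 : e (n + 1) = k := by omega
          rw [h1, h3, if_pos rfl, if_neg (by omega)]
          push_cast
          rw [hk]
          linarith
    rw [hval]
    split_ifs
    exacts [Or.inl rfl, Or.inr rfl]
  have hlow : ∀ {y}, IsLow (2 * k + 1) q y →
      y = 1 - η ∨ y = 1 - D - η ∨ q * y ≤ q - 1 - q * η := by
    intro y hy
    refine IsLow.induction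
      (Q := fun y => y = 1 - η ∨ y = 1 - D - η ∨ q * y ≤ q - 1 - q * η) hq hqm
      (Or.inr (Or.inr ?_)) ?_ ?_ hy
    · linarith
    · intro d e y _ he hy1 hyd
      have hqy : q * y < q := mul_lt_of_lt_one_right hq0 hy1
      rcases hpair he with h | h
      · rw [h] at hyd
        have hdk : (d : ℝ) < (k + 1 : ℕ) := by push_cast; linarith
        rw [Nat.cast_lt] at hdk
        rcases (Nat.lt_succ_iff.1 hdk).lt_or_eq with h1 | h1
        · have : (d : ℝ) + 1 ≤ k := by exact_mod_cast h1
          right; right; linarith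
        · right; left
          rw [h1] at hyd
          exact mul_left_cancel₀ hq0.ne' (by linarith)
      · rw [h] at hyd
        have hdk : (d : ℝ) < (k + 2 : ℕ) := by push_cast; linarith
        rw [Nat.cast_lt] at hdk
        rcases (Nat.lt_succ_iff.1 hdk).lt_or_eq with h1 | h1
        · have : (d : ℝ) ≤ k := by exact_mod_cast Nat.lt_succ_iff.1 h1
          right; right; linarith
        · left
          rw [h1] at hyd
          push_cast at hyd
          exact mul_left_cancel₀ hq0.ne' (by linarith)
    · rintro y - (h | h | h)
      · rcases Nat.eq_zero_or_pos k with h1 | h1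
        · rw [h1, Nat.cast_zero] at hk
          right; left
          exact mul_left_cancel₀ hq0.ne' (by linarith)
        · have : (1 : ℝ) ≤ k := by exact_mod_cast h1
          right; right; linarith
      · right; right; linarith
      · right; right
        have h2 : 0 ≤ q - 1 - q * η := by linarith
        exact le_of_mul_le_mul_left (h.trans (le_mul_of_one_le_left h2 hq.le)) hq0
  have hcases : ∀ {y}, IsLow (2 * k + 1) q y → (∃ d : ℕ, q * y = d + (1 - η)) ∨
      (∃ d : ℕ, q * y = d + (1 - D - η)) ∨
      (IsLow (2 * k + 1) q (q * y) ∧ q * (q * y) ≤ q - 1 - q * η) := by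
    intro y hy
    rcases hy.cases hq hqm with h | ⟨d, e, _, he, h⟩
    · rcases hlow h with h1 | h1 | h1
      · exact Or.inl ⟨0, by rw [h1]; simp⟩
      · exact Or.inr (Or.inl ⟨0, by rw [h1]; simp⟩)
      · exact Or.inr (Or.inr ⟨h, h1⟩)
    · rcases hpair he with h1 | h1
      · exact Or.inl ⟨d, by rw [h, h1]⟩
      · exact Or.inr (Or.inl ⟨d, by rw [h, h1]⟩)
  have h1s : ∀ {d : ℕ} {y z : ℝ}, y + z = 2 - D - 2 * η - 1 → q * y = d + (1 - η) →
      ¬ (IsLow (2 * k + 1) q (q * z) ∧ q * (q * z) ≤ q - 1 - q * η) := by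
    rintro d y z hyz h1 ⟨h2, h3⟩
    have h4 : q * z = k - d - q * η := by
      have : q * z = q * (2 - D - 2 * η - 1) - q * y := by rw [← hyz]; ring
      rw [this, h1, hk]
      linarith
    have h5 := h2.nonneg hq
    have h6 : (d : ℝ) < k := by linarith
    have h7 : (d : ℝ) + 1 ≤ k := by exact_mod_cast h6
    have h8 : q * (1 - q * η) ≤ q * (q * z) := mul_le_mul_of_nonneg_left (by linarith) hq0.le
    linarith
  have h2s : ∀ {d : ℕ} {y z : ℝ}, y + z = 2 - D - 2 * η - 1 → q * y = d + (1 - D - η) →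
      ¬ (IsLow (2 * k + 1) q (q * z) ∧ q * (q * z) ≤ q - 1 - q * η) := by
    rintro d y z hyz h1 ⟨h2, h3⟩
    have h4 : q * z = k - d + D - q * η := by
      have : q * z = q * (2 - D - 2 * η - 1) - q * y := by rw [← hyz]; ring
      rw [this, h1, hk]
      linarith
    have h5 := h2.nonneg hq
    have h6 : (d : ℝ) < (k + 1 : ℕ) := by push_cast; linarith
    rw [Nat.cast_lt] at h6
    rcases (Nat.lt_succ_iff.1 h6).lt_or_eq with h7 | h7
    · have h7 : (d : ℝ) + 1 ≤ k := by exact_mod_cast h7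
      have h8 : q * (1 - q * η) ≤ q * (q * z) := mul_le_mul_of_nonneg_left (by linarith) hq0.le
      linarith
    · have h8 : q * z = D - q * η := by rw [h4, h7]; ring
      have h9 : q * (q * z) = 1 - D - q ^ 2 * η := by rw [h8]; linarith
      rcases hcases h2 with ⟨d', h⟩ | ⟨d', h⟩ | ⟨-, h⟩
      · have : (0 : ℝ) ≤ d' := Nat.cast_nonneg d'
        linarith
      · have : (0 : ℝ) ≤ d' := Nat.cast_nonneg d'
        linarith
      · rw [h9] at h
        linarith
  have hgap : ∀ {d d' : ℕ} {t : ℝ} {a : ℕ}, (k : ℝ) + 1 - d - d' = t → (a : ℝ) < t →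
      t < a + 1 → False := by
    intro d d' t a h1 h2 h3
    have h4 : ((a + d + d' : ℕ) : ℝ) < (k + 1 : ℕ) := by push_cast; linarith
    have h5 : ((k + 1 : ℕ) : ℝ) < (a + 1 + d + d' : ℕ) := by push_cast; linarith
    rw [Nat.cast_lt] at h4 h5
    omega
  have hsum : q * y + q * z = k + 1 - (q + 1) * η := by
    have : q * y + q * z = q * (2 - D - 2 * η - 1) := by rw [← hyz]; ring
    rw [this, hk]
    linarith
  have hzy : z + y = 2 - D - 2 * η - 1 := by linarith
  have hpos : 0 < (q - 1) * η := by positivity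
  rcases hcases hy with ⟨d, h1⟩ | ⟨d, h1⟩ | h1
  · rcases hcases hz with ⟨d', h2⟩ | ⟨d', h2⟩ | h2
    · exact hgap (d := d) (d' := d') (a := 2) (t := 2 + (q - 1) * η) (by linarith)
        (by push_cast; linarith) (by push_cast; linarith)
    · exact hgap (d := d) (d' := d') (a := 1) (t := 2 - D + (q - 1) * η) (by linarith)
        (by push_cast; linarith) (by push_cast; linarith)
    · exact h1s hyz h1 h2
  · rcases hcases hz with ⟨d', h2⟩ | ⟨d', h2⟩ | h2
    · exact hgap (d := d) (d' := d') (a := 1) (t := 2 - D + (q - 1) * η) (by linarith)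
        (by push_cast; linarith) (by push_cast; linarith)
    · exact hgap (d := d) (d' := d') (a := 1) (t := 2 - 2 * D + (q - 1) * η) (by linarith)
        (by push_cast; linarith) (by push_cast; linarith)
    · exact h2s hyz h1 h2
  · rcases hcases hz with ⟨d', h2⟩ | ⟨d', h2⟩ | h2
    · exact h1s hzy h2 h1
    · exact h2s hzy h2 h1
    · have h3 : q * (q * y) + q * (q * z) = q * (q * (2 - D - 2 * η - 1)) := by rw [← hyz]; ring
      have h4 : q * (q * D) = q - 1 + D := by rw [hDq]; linarith
      have h5 := h1.2
      have h6 := h2.2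
      nlinarith [sq_nonneg (q - 3 / 2)]

end Odd

/-- An explicit lower bound for the bases in `B_2(m)`. -/
def AboveBound (m : ℕ) (q : ℝ) : Prop :=
  ∀ k : ℕ, (m = 2 * k → 1 ≤ q ^ 2 - (k + 1) * q) ∧
    (m = 2 * k + 1 → 1 ≤ (q ^ 2 - (k + 1) * q - (k + 1)) * q * (q + 1))

section Characterization

variable {m : ℕ} {q : ℝ}

lemma aboveBound_of_strict_pair (hm : 0 < m) (hq : 1 < q) (hqm : q ≤ m + 1) {c d : ℕ → ℕ}
    (hc : IsStrict m q c) (hd : IsStrict m q d) (hv : tailVal q d 0 = tailVal q c 0 + 1) :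
    AboveBound m q := by
  have hL := lt_two_of_strict_pair hm hq hqm hc hd hv
  obtain ⟨y, z, hy, hz, hyz⟩ := exists_low_pair hm hq hqm hc hd hv
  refine fun k => ⟨?_, ?_⟩
  · rintro rfl
    exact even_bound (by omega) hq hqm hL hy hz hyz
  · rintro rfl
    exact odd_bound hq hqm hy hz hyz

lemma odd_pos_of_bound (hq : 0 < q) {k : ℕ}
    (h : 1 ≤ (q ^ 2 - (k + 1) * q - (k + 1)) * q * (q + 1)) :
    0 < q ^ 2 - (k + 1) * q - (k + 1) := by
  by_contra! hf
  have h1 : (q ^ 2 - (k + 1) * q - (k + 1)) * (q * (q + 1)) ≤ 0 :=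
    mul_nonpos_of_nonpos_of_nonneg hf (by positivity)
  linarith

lemma AboveBound.lt (hq : 0 < q) (h : AboveBound m q) : (m : ℝ) / 2 + 1 < q := by
  rcases Nat.even_or_odd' m with ⟨k, hk | hk⟩
  · have h1 := (h k).1 hk
    rw [hk]
    push_cast
    by_contra! hcon
    have : q * (q - (k + 1)) ≤ 0 := mul_nonpos_of_nonneg_of_nonpos hq.le (by linarith)
    linarith
  · have h1 := odd_pos_of_bound hq ((h k).2 hk)
    have hk0 : (0 : ℝ) ≤ k := Nat.cast_nonneg k
    rw [hk]
    push_cast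
    by_contra! hcon
    have : q * (q - (k + 1)) ≤ q * (1 / 2) := mul_le_mul_of_nonneg_left (by linarith) hq.le
    linarith

lemma AboveBound.digit (hq : 1 < q) (h : AboveBound m q) {d : ℕ}
    (hd : (d : ℝ) = q - ((m : ℝ) / (q - 1) - 1)) : m + 2 ≤ 2 * d := by
  have hlt := h.lt (by linarith)
  have hq1 : 0 < q - 1 := by linarith
  rcases Nat.even_or_odd' m with ⟨k, hk | hk⟩
  · have h1 : (m : ℝ) / (q - 1) < 2 := by
      rw [div_lt_iff₀ hq1]
      linarith
    have h2 : (m : ℝ) < (2 * d : ℕ) := by push_cast; linarith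
    rw [Nat.cast_lt] at h2
    omega
  · have h1 := odd_pos_of_bound (by linarith) ((h k).2 hk)
    have h2 : (m : ℝ) / (q - 1) < q - k := by
      rw [div_lt_iff₀ hq1, hk]
      push_cast
      linarith
    have h3 : ((k + 1 : ℕ) : ℝ) < d := by push_cast; linarith
    rw [Nat.cast_lt] at h3
    omega

lemma mem_B2_iff (hm : 0 < m) : q ∈ B2 m ↔ q ∈ Set.Icc (3 / 2 : ℝ) (m + 1) ∧ AboveBound m q ∧
    ∃ c d, IsWeak m q c ∧ IsWeak m q d ∧ tailVal q d 0 = tailVal q c 0 + 1 := by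
  have hm1 : (1 : ℝ) ≤ m := by exact_mod_cast hm
  constructor
  · intro h
    obtain ⟨hq, hqm, c, d, hc, hd, hv⟩ := exists_strict_pair_of_mem_B2 h
    have hb := aboveBound_of_strict_pair hm hq hqm hc hd hv
    exact ⟨⟨by linarith [hb.lt (by linarith)], hqm⟩, hb, c, d, hc.isWeak, hd.isWeak, hv⟩
  · rintro ⟨⟨hq, hqm⟩, hb, c, d, hc, hd, hv⟩
    have hq1 : 1 < q := by linarith
    have hlt := hb.lt (by linarith)
    have hL2 : (m : ℝ) / (q - 1) < 2 := by
      rw [div_lt_iff₀ (by linarith)]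
      linarith
    rcases hqm.lt_or_eq with h | h
    · have hL : 1 < (m : ℝ) / (q - 1) := by
        rw [lt_div_iff₀ (by linarith)]
        linarith
      obtain ⟨c, d, hc, hd, hv⟩ :=
        exists_strict_pair_of_weak_pair hq1 hL hlt (fun d => hb.digit hq1) hc hd hv
      exact mem_B2_of_strict_pair hm hq1 hqm hL2 hc hd hv
    · have hL : (m : ℝ) / (q - 1) = 1 := by
        rw [h, add_sub_cancel_right, div_self (by linarith)]
      have hz := isStrict_zero m q
      refine mem_B2_of_strict_pair hm hq1 hqm hL2 hz (hz.reflect hq1) ?_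
      rw [tailVal_reflect hq1 hz.1, hL]
      simp [tailVal]

end Characterization

section Compactness

variable {m : ℕ}

lemma continuous_tailVal_max (m n : ℕ) :
    Continuous fun p : ℝ × (ℕ → Fin (m + 1)) =>
      tailVal (max p.1 (3 / 2)) (fun i => (p.2 i : ℕ)) n := by
  unfold tailVal
  have h0 : ∀ q : ℝ, 0 < max q (3 / 2) := fun q => lt_max_of_lt_right (by norm_num)
  refine continuous_tsum (u := fun i => (m : ℝ) / (3 / 2) ^ (i + 1)) (fun i => ?_)
    (hasSum_geometric_digits m (by norm_num)).summable (fun i p => ?_)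
  · refine Continuous.div ?_ (by fun_prop) fun p => (pow_pos (h0 p.1) _).ne'
    exact (continuous_of_discreteTopology (f := fun x : Fin (m + 1) => ((x : ℕ) : ℝ))).comp
      ((continuous_apply (n + i)).comp continuous_snd)
  · have h1 : ((p.2 (n + i) : ℕ) : ℝ) ≤ m := by exact_mod_cast Nat.lt_succ_iff.1 (p.2 (n + i)).2
    have h2 := h0 p.1
    have h3 : (3 / 2 : ℝ) ≤ max p.1 (3 / 2) := le_max_right _ _
    rw [Real.norm_of_nonneg (by positivity)]
    gcongr

lemma isClosed_aboveBound (m : ℕ) : IsClosed {q : ℝ | AboveBound m q} := by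
  simp only [AboveBound, Set.ofPred_forall, Set.ofPred_and]
  refine isClosed_iInter fun k => IsClosed.inter ?_ ?_ <;>
  · refine isClosed_iInter fun _ => isClosed_le (by fun_prop) (by fun_prop)

lemma isClosed_isWeak (m : ℕ) : IsClosed {p : ℝ × (ℕ → Fin (m + 1)) |
    IsWeak m (max p.1 (3 / 2)) fun i => (p.2 i : ℕ)} := by
  have hdig : ∀ (P : ℕ → Prop) (n : ℕ),
      IsOpen {p : ℝ × (ℕ → Fin (m + 1)) | P (p.2 n : ℕ)} := by
    intro P n
    have h : Continuous fun p : ℝ × (ℕ → Fin (m + 1)) => p.2 n := by fun_prop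
    exact (isOpen_discrete {x : Fin (m + 1) | P x}).preimage h
  have hne : ∀ q : ℝ, max q (3 / 2) - 1 ≠ 0 := fun q => by
    have : (3 / 2 : ℝ) ≤ max q (3 / 2) := le_max_right _ _
    linarith
  have heq : {p : ℝ × (ℕ → Fin (m + 1)) | IsWeak m (max p.1 (3 / 2)) fun i => (p.2 i : ℕ)} =
      ⋂ n, {p | (p.2 n : ℕ) < m → tailVal (max p.1 (3 / 2)) (fun i => (p.2 i : ℕ)) (n + 1) ≤ 1} ∩
        {p | 0 < (p.2 n : ℕ) → (m : ℝ) / (max p.1 (3 / 2) - 1) - 1 ≤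
          tailVal (max p.1 (3 / 2)) (fun i => (p.2 i : ℕ)) (n + 1)} := by
    ext p
    simp only [IsWeak, Set.mem_ofPred_eq, Set.mem_iInter, Set.mem_inter_iff]
    exact and_iff_right fun i => Nat.lt_succ_iff.1 (p.2 i).2
  rw [heq]
  refine isClosed_iInter fun n => IsClosed.inter ?_ ?_
  · exact isClosed_imp (hdig (· < m) n)
      (isClosed_le (continuous_tailVal_max m (n + 1)) continuous_const)
  · refine isClosed_imp (hdig (0 < ·) n) (isClosed_le ?_ (continuous_tailVal_max m (n + 1)))
    have h : Continuous fun p : ℝ × (ℕ → Fin (m + 1)) => max p.1 (3 / 2) - 1 := by fun_prop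
    exact (continuous_const.div h fun p => hne p.1).sub continuous_const

end Compactness

/-- `B_2(m)` is compact. -/
theorem stmt12 (m : ℕ) (hm : 0 < m) : IsCompact (B2 m) := by
  let K : Set (ℝ × (ℕ → Fin (m + 1)) × (ℕ → Fin (m + 1))) :=
    {p | AboveBound m p.1} ∩
      ({p | IsWeak m (max p.1 (3 / 2)) fun i => (p.2.1 i : ℕ)} ∩
        ({p | IsWeak m (max p.1 (3 / 2)) fun i => (p.2.2 i : ℕ)} ∩
          {p | tailVal (max p.1 (3 / 2)) (fun i => (p.2.2 i : ℕ)) 0 =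
            tailVal (max p.1 (3 / 2)) (fun i => (p.2.1 i : ℕ)) 0 + 1}))
  have h1 : Continuous fun p : ℝ × (ℕ → Fin (m + 1)) × (ℕ → Fin (m + 1)) => (p.1, p.2.1) := by
    fun_prop
  have h2 : Continuous fun p : ℝ × (ℕ → Fin (m + 1)) × (ℕ → Fin (m + 1)) => (p.1, p.2.2) := by
    fun_prop
  have hK : IsClosed K :=
    ((isClosed_aboveBound m).preimage continuous_fst).inter
      (((isClosed_isWeak m).preimage h1).inter (((isClosed_isWeak m).preimage h2).inter
        (isClosed_eq ((continuous_tailVal_max m 0).comp h2)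
          (((continuous_tailVal_max m 0).comp h1).add continuous_const))))
  have hcomp : IsCompact ((Set.Icc (3 / 2 : ℝ) (m + 1) ×ˢ Set.univ) ∩ K) :=
    (isCompact_Icc.prod isCompact_univ).inter_right hK
  convert hcomp.image continuous_fst using 1
  ext q
  rw [mem_B2_iff hm]
  constructor
  · rintro ⟨hq, hb, c, d, hc, hd, hv⟩
    have hmax : max q (3 / 2) = q := max_eq_left hq.1
    refine ⟨(q, (fun i => ⟨c i, Nat.lt_succ_iff.2 (hc.1 i)⟩),
      fun i => ⟨d i, Nat.lt_succ_iff.2 (hd.1 i)⟩), ⟨⟨hq, Set.mem_univ _⟩, hb, ?_, ?_, ?_⟩, rfl⟩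
    · simpa only [Set.mem_ofPred_eq, hmax] using hc
    · simpa only [Set.mem_ofPred_eq, hmax] using hd
    · simpa only [Set.mem_ofPred_eq, hmax] using hv
  · rintro ⟨⟨q', c, d⟩, ⟨⟨hq, -⟩, hb, hc, hd, hv⟩, rfl⟩
    have hmax : max q' (3 / 2) = q' := max_eq_left hq.1
    simp only [Set.mem_ofPred_eq, hmax] at hc hd hv
    exact ⟨hq, hb, _, _, hc, hd, hv⟩
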